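/- Let M be a weight sequence satisfying the moderate growth condition, let Ω be an open subset of ℝ, and let f : Ω → ℂ be a function. Suppose there are non-zero natural numbers p and q with gcd(p,q) = 1 such that both functions f^p : x ↦ (f(x))^p and f^q : x ↦ (f(x))^q are smooth and of class C_M on Ω. Then f is smooth and of class C_M on Ω. -/

import Mathlib

open Set Filter MeasureTheory Topology

/-- A weight sequence: positive, nondecreasing, `M 0 = 1`, logarithmically convex
(the sequence of ratios `M (j+1) / M j` is nondecreasing), and `M j ^ (1/j) → ∞`. -/
def IsWeightSeq (M : ℕ → ℝ) : Prop :=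
  (∀ j, 0 < M j) ∧ Monotone M ∧ M 0 = 1 ∧
  (∀ j, M (j + 1) / M j ≤ M (j + 2) / M (j + 1)) ∧
  Tendsto (fun j : ℕ => (M j) ^ (1 / (j : ℝ))) atTop atTop

/-- The moderate growth condition. -/
def ModerateGrowth (M : ℕ → ℝ) : Prop :=
  ∃ A > 0, ∀ j k : ℕ, M (j + k) ≤ A ^ (j + k) * (M j * M k)

/-- The strong non-quasianalyticity condition. -/
def StrongNQA (M : ℕ → ℝ) : Prop :=
  ∃ A > 0, ∀ k : ℕ, ∑' j : ℕ, M (k + j) / (((k + j : ℕ) + 1) * M ((k + j) + 1))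
      ≤ A * (M k / M (k + 1))

/-- A function `f` is smooth and of class `C_M` on an open set `Ω ⊆ ℝ`. -/
def IsCMOn (M : ℕ → ℝ) (f : ℝ → ℂ) (Ω : Set ℝ) : Prop :=
  ContDiffOn ℝ (⊤ : ℕ∞) f Ω ∧
  ∀ X : Set ℝ, X ⊆ Ω → IsCompact X →
    ∃ σ > 0, ∃ C ≥ 0, ∀ j : ℕ, ∀ x ∈ X,
      ‖iteratedDerivWithin j f Ω x‖ ≤ C * σ ^ j * (j.factorial : ℝ) * M j

/-- Bernstein–Walsh type inequality: a polynomial which is small on `[-1, 1]` is controlled on `ℂ`. -/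
theorem norm_eval_le_of_norm_le_on_unit_interval (P : Polynomial ℂ) (m : ℕ) (hd : P.natDegree ≤ m)
    (δ : ℝ) (h : ∀ x : ℝ, |x| ≤ 1 → ‖P.eval (x : ℂ)‖ ≤ δ) (z : ℂ) :
    ‖P.eval z‖ ≤ δ * (2 * ‖z‖ + 1) ^ m := by
  let Q : ℂ → ℂ := fun w =>
    ∑ k ∈ Finset.range (m + 1), P.coeff k * ((w ^ 2 + 1) / 2) ^ k * w ^ (m - k)
  have hQ : Differentiable ℂ Q := by
    intro w
    apply DifferentiableAt.fun_sum
    intro k _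
    fun_prop
  have hQe : ∀ w : ℂ, w ≠ 0 → Q w = w ^ m * P.eval ((w + w⁻¹) / 2) := by
    intro w hw
    rw [Polynomial.eval_eq_sum_range' (Nat.lt_succ_of_le hd), Finset.mul_sum]
    refine Finset.sum_congr rfl fun k hk => ?_
    have hk' : k ≤ m := Nat.lt_succ_iff.mp (Finset.mem_range.mp hk)
    have h1 : (w ^ 2 + 1) / 2 = w * ((w + w⁻¹) / 2) := by field_simp
    have h2 : w ^ m = w ^ k * w ^ (m - k) := by rw [← pow_add, Nat.add_sub_cancel' hk']
    rw [h1, h2, mul_pow]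
    ring
  have hQb : ∀ w ∈ Metric.closedBall (0 : ℂ) 1, ‖Q w‖ ≤ δ := by
    intro w hw
    rw [← closure_ball (0 : ℂ) one_ne_zero] at hw
    refine Complex.norm_le_of_forall_mem_frontier_norm_le Metric.isBounded_ball
      hQ.diffContOnCl (fun u hu => ?_) hw
    rw [frontier_ball (0 : ℂ) one_ne_zero, mem_sphere_zero_iff_norm] at hu
    have hu0 : u ≠ 0 := by
      rintro rfl
      simp at hu
    have hinv : u⁻¹ = (starRingEnd ℂ) u := by
      rw [Complex.inv_def, Complex.normSq_eq_norm_sq, hu]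
      simp
    have hre : (u + u⁻¹) / 2 = ((u.re : ℝ) : ℂ) := by
      rw [hinv, Complex.add_conj]
      push_cast
      ring
    rw [hQe u hu0, hre, norm_mul, norm_pow, hu, one_pow, one_mul]
    exact h _ (by rw [← hu]; exact Complex.abs_re_le_norm u)
  obtain ⟨w, hw0, hw1, hwz⟩ : ∃ w : ℂ, w ≠ 0 ∧ ‖w‖ ≤ 1 ∧ (w + w⁻¹) / 2 = z := by
    obtain ⟨s, hs⟩ := IsAlgClosed.exists_pow_nat_eq (z ^ 2 - 1) (n := 2) (by norm_num)
    have hprod : (z + s) * (z - s) = 1 := by linear_combination -hs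
    have hne : z + s ≠ 0 := left_ne_zero_of_mul_eq_one hprod
    have hne' : z - s ≠ 0 := right_ne_zero_of_mul_eq_one hprod
    have hnorm : ‖z + s‖ * ‖z - s‖ = 1 := by rw [← norm_mul, hprod, norm_one]
    rcases le_total ‖z + s‖ 1 with h1 | h1
    · refine ⟨z + s, hne, h1, ?_⟩
      rw [← eq_inv_of_mul_eq_one_right hprod]
      ring
    · refine ⟨z - s, hne', ?_, ?_⟩
      · nlinarith [norm_nonneg (z - s)]
      · rw [← eq_inv_of_mul_eq_one_left hprod]
        ring
  have hwpos : 0 < ‖w‖ := norm_pos_iff.mpr hw0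
  have h1 : ‖w‖ ^ m * ‖P.eval z‖ ≤ δ := by
    have := hQb w (by simpa using hw1)
    rwa [hQe w hw0, hwz, norm_mul, norm_pow] at this
  have h2 : ‖w⁻¹‖ ≤ 2 * ‖z‖ + 1 := by
    have : w⁻¹ = 2 * z - w := by rw [← hwz]; ring
    rw [this]
    calc ‖2 * z - w‖ ≤ ‖2 * z‖ + ‖w‖ := norm_sub_le _ _
      _ ≤ 2 * ‖z‖ + 1 := by simpa using hw1
  have hδ : 0 ≤ δ := (norm_nonneg _).trans (h 0 (by simp))
  calc ‖P.eval z‖ = (‖w‖ ^ m * ‖P.eval z‖) * ‖w⁻¹‖ ^ m := by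
        rw [norm_inv, inv_pow]
        field_simp
    _ ≤ δ * (2 * ‖z‖ + 1) ^ m := by gcongr

/-- A product of `m` distances to real points is large somewhere on every interval. -/
theorem exists_prod_abs_sub_ge (s : Multiset ℝ) (c ρ : ℝ) (hρ : 0 < ρ) :
    ∃ r : ℝ, |r - c| ≤ ρ ∧ (ρ / 4) ^ s.card ≤ (s.map fun γ => |r - γ|).prod := by
  by_contra! hcon
  let R : Polynomial ℂ :=
    (s.map fun γ => Polynomial.C (ρ : ℂ) * Polynomial.X + Polynomial.C ((c - γ : ℝ) : ℂ)).prod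
  have hRe : ∀ z : ℂ, ‖R.eval z‖ = (s.map fun γ => ‖ρ * z + (c - γ : ℝ)‖).prod := by
    intro z
    simp only [R, Polynomial.eval_multiset_prod, Multiset.map_map]
    rw [← coe_nnnorm, ← nnnormHom_apply, map_multiset_prod, NNReal.coe_multiset_prod]
    simp [Multiset.map_map, Function.comp_def]
  have hdeg : R.natDegree ≤ s.card := by
    refine (Polynomial.natDegree_multiset_prod_le _).trans ?_
    rw [Multiset.map_map]
    refine (Multiset.sum_le_card_nsmul _ 1 ?_).trans (by simp)
    intro x hx
    obtain ⟨γ, _, rfl⟩ := Multiset.mem_map.mp hx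
    exact Polynomial.natDegree_linear_le
  rcases Multiset.empty_or_exists_mem s with rfl | ⟨γ₀, hγ₀⟩
  · have := hcon c (by simp [hρ.le])
    simp at this
  have hcard : 0 < s.card := Multiset.card_pos_iff_exists_mem.mpr ⟨γ₀, hγ₀⟩
  have hsmall : ∀ x : ℝ, |x| ≤ 1 → ‖R.eval (x : ℂ)‖ ≤ (ρ / 4) ^ s.card := by
    intro x hx
    have := hcon (c + ρ * x) (by
      rw [add_sub_cancel_left, abs_mul, abs_of_pos hρ]
      nlinarith)
    rw [hRe]
    refine le_trans (le_of_eq ?_) this.le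
    congr 1
    refine Multiset.map_congr rfl fun γ _ => ?_
    rw [← Complex.ofReal_mul, ← Complex.ofReal_add, Complex.norm_real, Real.norm_eq_abs]
    congr 1
    ring
  have h1 := norm_eval_le_of_norm_le_on_unit_interval R s.card hdeg _ hsmall Complex.I
  have h2 : ρ ^ s.card ≤ ‖R.eval Complex.I‖ := by
    rw [hRe]
    have : ρ ^ s.card = (s.map fun _ => ρ).prod := by simp
    rw [this]
    refine Multiset.prod_map_le_prod_map₀ _ _ (fun _ _ => hρ.le) fun γ _ => ?_
    have := Complex.abs_im_le_norm (ρ * Complex.I + (c - γ : ℝ))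
    simpa [abs_of_pos hρ] using this
  have h3 : ρ ^ s.card ≤ (3 / 4 * ρ) ^ s.card := by
    refine h2.trans (h1.trans (le_of_eq ?_))
    rw [← mul_pow, Complex.norm_I]
    congr 1
    ring
  have h4 : (3 / 4 * ρ) ^ s.card < ρ ^ s.card := by
    apply pow_lt_pow_left₀ (by linarith) (by positivity) hcard.ne'
  linarith

/-- Cartan type estimate: a polynomial admits a quantitative lower bound on some circle. -/
theorem exists_circle_norm_eval_ge (G : Polynomial ℂ) (n : ℕ) (hG : G.natDegree ≤ n) (z₀ : ℂ)
    (hz₀ : ‖z₀‖ ≤ 1) (c ρ : ℝ) (hρ : 0 < ρ) (hc : 0 ≤ c - ρ) (hc' : c + ρ ≤ 1) :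
    ∃ r : ℝ, |r - c| ≤ ρ ∧ ∀ z : ℂ, ‖z‖ = r → ‖G.eval z₀‖ * (ρ / 16) ^ n ≤ ‖G.eval z‖ := by
  obtain ⟨r, hr, hprod⟩ := exists_prod_abs_sub_ge (G.roots.map fun w => min ‖w‖ 2) c ρ hρ
  refine ⟨r, hr, fun z hz => ?_⟩
  rw [abs_le] at hr
  have hsplit : ∀ u : ℂ, ‖G.eval u‖ =
      ‖G.leadingCoeff‖ * (G.roots.map fun w => ‖u - w‖).prod := by
    intro u
    rw [(IsAlgClosed.splits G).eval_eq_prod_roots, norm_mul, ← coe_nnnorm (Multiset.prod _),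
      ← nnnormHom_apply, map_multiset_prod, NNReal.coe_multiset_prod]
    simp [Multiset.map_map, Function.comp_def]
  rw [Multiset.card_map, Multiset.map_map] at hprod
  have hcard : G.roots.card ≤ n := (Polynomial.card_roots' G).trans hG
  have hmain : (G.roots.map fun w => ‖z₀ - w‖).prod * (ρ / 16) ^ G.roots.card ≤
      (G.roots.map fun w => ‖z - w‖).prod := by
    have h4 : (ρ / 16) ^ G.roots.card = (ρ / 4) ^ G.roots.card * (1 / 4) ^ G.roots.card := by
      rw [← mul_pow]
      congr 1
      ring
    have hnn : 0 ≤ (G.roots.map fun w => ‖z₀ - w‖).prod :=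
      Multiset.prod_nonneg (by
        intro x hx
        obtain ⟨w, _, rfl⟩ := Multiset.mem_map.mp hx
        exact norm_nonneg _)
    calc (G.roots.map fun w => ‖z₀ - w‖).prod * (ρ / 16) ^ G.roots.card
        ≤ (G.roots.map fun w => ‖z₀ - w‖).prod *
          ((G.roots.map ((fun γ => |r - γ|) ∘ fun w => min ‖w‖ 2)).prod *
            (1 / 4) ^ G.roots.card) := by
          rw [h4]
          gcongr
      _ = (G.roots.map fun w => ‖z₀ - w‖ * (|r - min ‖w‖ 2| * (1 / 4))).prod := by
          rw [Multiset.prod_map_mul, Multiset.prod_map_mul]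
          simp
      _ ≤ (G.roots.map fun w => ‖z - w‖).prod := by
          refine Multiset.prod_map_le_prod_map₀ _ _ (fun _ _ => by positivity) fun w _ => ?_
          have hm0 : 0 ≤ min ‖w‖ 2 := le_min (norm_nonneg _) (by norm_num)
          have hm1 : |r - min ‖w‖ 2| ≤ ‖z - w‖ := by
            have h5 := abs_norm_sub_norm_le z w
            rw [hz] at h5
            refine le_trans ?_ h5
            rcases le_total ‖w‖ 2 with h | h
            · rw [min_eq_left h]
            · rw [min_eq_right h, abs_of_nonpos (by linarith), abs_of_nonpos (by linarith)]
              linarith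
          have hm2 : |r - min ‖w‖ 2| ≤ 2 := by
            rw [abs_le]
            constructor <;> linarith [min_le_right ‖w‖ 2]
          have h6 : ‖z₀ - w‖ ≤ ‖z - w‖ + 2 := by
            calc ‖z₀ - w‖ = ‖(z - w) + (z₀ - z)‖ := by congr 1; ring
              _ ≤ ‖z - w‖ + (‖z₀‖ + ‖z‖) := (norm_add_le _ _).trans (by gcongr; exact norm_sub_le _ _)
              _ ≤ ‖z - w‖ + 2 := by linarith
          nlinarith [abs_nonneg (r - min ‖w‖ 2), norm_nonneg (z - w)]
  have hpow : (ρ / 16) ^ n ≤ (ρ / 16) ^ G.roots.card :=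
    pow_le_pow_of_le_one (by positivity) (by linarith) hcard
  rw [hsplit, hsplit, mul_assoc]
  refine mul_le_mul_of_nonneg_left (le_trans ?_ hmain) (norm_nonneg _)
  refine mul_le_mul_of_nonneg_left hpow (Multiset.prod_nonneg (by
    intro x hx
    obtain ⟨w, _, rfl⟩ := Multiset.mem_map.mp hx
    exact norm_nonneg _))

/-- Twice the Wirtinger derivative `∂g/∂z̄`. -/
noncomputable def dbar (g : ℂ → ℂ) (z : ℂ) : ℂ :=
  fderiv ℝ g z 1 + Complex.I * fderiv ℝ g z Complex.I

theorem continuous_dbar {g : ℂ → ℂ} (hg : ContDiff ℝ 1 g) : Continuous (dbar g) := by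
  have h := hg.continuous_fderiv one_ne_zero
  unfold dbar
  fun_prop

theorem circleIntegral_eq_integral_exp (g : ℂ → ℂ) (x : ℝ) :
    (∮ z in C(0, Real.exp x), g z) =
      Complex.I • ∫ y : ℝ in (0)..(2 * Real.pi),
        g (Complex.exp (x + y * Complex.I)) * Complex.exp (x + y * Complex.I) := by
  rw [circleIntegral, smul_eq_mul, ← intervalIntegral.integral_const_mul]
  refine intervalIntegral.integral_congr fun y _ => ?_
  have h : circleMap 0 (Real.exp x) y = Complex.exp (x + y * Complex.I) := by
    rw [circleMap, zero_add, Complex.exp_add, Complex.ofReal_exp]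
  simp only [deriv_circleMap, h, smul_eq_mul]
  ring

/-- **Green's formula** on an annulus. -/
theorem circleIntegral_sub_circleIntegral_eq (g : ℂ → ℂ) (hg : ContDiff ℝ 1 g) (x₀ x₁ : ℝ) :
    (∮ z in C(0, Real.exp x₁), g z) - (∮ z in C(0, Real.exp x₀), g z) =
      ∫ x : ℝ in x₀..x₁, ∫ y : ℝ in (0)..(2 * Real.pi),
        Complex.I * ((Real.exp (2 * x) : ℝ) * dbar g (Complex.exp (x + y * Complex.I))) := by
  have hgd : Differentiable ℝ g := hg.differentiable one_ne_zero
  let X : ℂ → ℂ := fun w => g (Complex.exp w) * Complex.exp w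
  have hexp : ContDiff ℝ 1 Complex.exp := Complex.contDiff_exp
  have hX : ContDiff ℝ 1 X := (hg.comp hexp).mul hexp
  have hX' := hX.continuous_fderiv one_ne_zero
  have hderiv : ∀ w, Complex.I • fderiv ℝ X w 1 - fderiv ℝ X w Complex.I =
      Complex.I * ((Complex.exp w * (starRingEnd ℂ) (Complex.exp w)) * dbar g (Complex.exp w)) := by
    intro w
    have he : HasFDerivAt Complex.exp
        ((ContinuousLinearMap.toSpanSingleton ℂ (Complex.exp w)).restrictScalars ℝ) w :=
      (Complex.hasDerivAt_exp w).hasFDerivAt.restrictScalars ℝ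
    have h1 : HasFDerivAt X _ w :=
      ((hgd (Complex.exp w)).hasFDerivAt.comp w he).mul he
    rw [h1.fderiv]
    have hlin : ∀ u : ℂ, fderiv ℝ g (Complex.exp w) u =
        u.re * fderiv ℝ g (Complex.exp w) 1 + u.im * fderiv ℝ g (Complex.exp w) Complex.I := by
      intro u
      have hu : u = u.re • (1 : ℂ) + u.im • Complex.I := by
        simp
      conv_lhs => rw [hu, map_add, map_smul, map_smul]
      simp
    simp only [dbar, _root_.add_apply, _root_.smul_apply,
      ContinuousLinearMap.comp_apply, ContinuousLinearMap.coe_restrictScalars',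
      ContinuousLinearMap.toSpanSingleton_apply, smul_eq_mul, one_mul, Function.comp_apply]
    rw [hlin (Complex.exp w), hlin (Complex.I * Complex.exp w)]
    have hc : (starRingEnd ℂ) (Complex.exp w) =
        (Complex.exp w).re - (Complex.exp w).im * Complex.I := by
      apply Complex.ext <;> simp
    rw [hc]
    simp only [Complex.mul_re, Complex.mul_im, Complex.I_re, Complex.I_im]
    push_cast
    linear_combination (Complex.exp w * (Complex.exp w).im *
      (fderiv ℝ g (Complex.exp w) 1 + Complex.I * fderiv ℝ g (Complex.exp w) Complex.I) -
        Complex.exp w * (Complex.exp w).re * fderiv ℝ g (Complex.exp w) Complex.I) * Complex.I_sq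
  have hrect := Complex.integral_boundary_rect_of_differentiableOn_real X
    (x₀ : ℂ) (x₁ + (2 * Real.pi : ℝ) * Complex.I) (hX.differentiable one_ne_zero).differentiableOn
    (by
      apply ContinuousOn.integrableOn_compact
      · exact isCompact_uIcc.reProdIm isCompact_uIcc
      · fun_prop)
  have hper : ∀ x : ℝ, X (x + (2 * Real.pi : ℝ) * Complex.I) = X x := by
    intro x
    simp only [X]
    push_cast
    rw [Complex.exp_periodic]
  simp only [Complex.ofReal_re, Complex.ofReal_im, Complex.add_re, Complex.add_im, Complex.mul_re,
    Complex.mul_im, Complex.I_re, Complex.I_im, mul_zero, mul_one, zero_mul, add_zero,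
    zero_add, hper, Complex.ofReal_zero, sub_self, hderiv] at hrect
  rw [circleIntegral_eq_integral_exp, circleIntegral_eq_integral_exp, hrect]
  refine intervalIntegral.integral_congr fun x _ => intervalIntegral.integral_congr fun y _ => ?_
  simp only [Complex.mul_conj, Complex.normSq_eq_norm_sq, Complex.norm_exp]
  rw [← Real.exp_nat_mul]
  simp

/-- Comparison of two contour integrals through their Wirtinger derivatives. -/
theorem norm_circleIntegral_le_of_dbar_le (g₁ g₂ : ℂ → ℂ) (hg₁ : ContDiff ℝ 1 g₁)
    (hg₂ : ContDiff ℝ 1 g₂) (r : ℝ) (hr : 0 < r)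
    (h : ∀ z : ℂ, ‖z‖ ≤ r → ‖dbar g₁ z‖ ≤ (dbar g₂ z).re) :
    ‖∮ z in C(0, r), g₁ z‖ ≤ ‖∮ z in C(0, r), g₂ z‖ := by
  have hD1 := continuous_dbar hg₁
  have hD2 := continuous_dbar hg₂
  have key : ∀ ε : ℝ, 0 < ε → ε < r →
      ‖(∮ z in C(0, r), g₁ z) - (∮ z in C(0, ε), g₁ z)‖ ≤
        ‖(∮ z in C(0, r), g₂ z) - (∮ z in C(0, ε), g₂ z)‖ := by
    intro ε hε hεr
    rw [← Real.exp_log hr, ← Real.exp_log hε, circleIntegral_sub_circleIntegral_eq g₁ hg₁,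
      circleIntegral_sub_circleIntegral_eq g₂ hg₂]
    have hlog : Real.log ε ≤ Real.log r := Real.log_le_log hε hεr.le
    have hpi : (0 : ℝ) ≤ 2 * Real.pi := by positivity
    have hcont : ∀ g : ℂ → ℂ, Continuous (dbar g) → Continuous (fun u : ℝ × ℝ =>
        Complex.I * ((Real.exp (2 * u.1) : ℝ) * dbar g (Complex.exp (u.1 + u.2 * Complex.I)))) := by
      intro g hg
      fun_prop
    have hcontr : Continuous (fun u : ℝ × ℝ =>
        Real.exp (2 * u.1) * (dbar g₂ (Complex.exp (u.1 + u.2 * Complex.I))).re) := by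
      have := Complex.continuous_re.comp hD2
      fun_prop
    have h1 : ‖∫ x : ℝ in Real.log ε..Real.log r, ∫ y : ℝ in (0)..(2 * Real.pi),
        Complex.I * ((Real.exp (2 * x) : ℝ) * dbar g₁ (Complex.exp (x + y * Complex.I)))‖ ≤
        ∫ x : ℝ in Real.log ε..Real.log r, ∫ y : ℝ in (0)..(2 * Real.pi),
          Real.exp (2 * x) * (dbar g₂ (Complex.exp (x + y * Complex.I))).re := by
      refine intervalIntegral.norm_integral_le_of_norm_le hlog ?_
        ((intervalIntegral.continuous_parametric_intervalIntegral_of_continuous' hcontr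
          0 (2 * Real.pi)).intervalIntegrable _ _)
      refine Eventually.of_forall fun x hx => ?_
      refine intervalIntegral.norm_integral_le_of_norm_le hpi ?_ ?_
      · refine Eventually.of_forall fun y _ => ?_
        have hz : ‖Complex.exp (x + y * Complex.I)‖ ≤ r := by
          rw [Complex.norm_exp]
          simpa using (Real.exp_le_exp.mpr hx.2).trans_eq (Real.exp_log hr)
        rw [norm_mul, Complex.norm_I, one_mul, norm_mul, Complex.norm_real, Real.norm_eq_abs,
          abs_of_pos (Real.exp_pos _)]
        exact mul_le_mul_of_nonneg_left (h _ hz) (Real.exp_pos _).le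
      · apply Continuous.intervalIntegrable
        exact hcontr.comp (Continuous.prodMk_right x)
    refine h1.trans ?_
    have h2 : (((∫ x : ℝ in Real.log ε..Real.log r, ∫ y : ℝ in (0)..(2 * Real.pi),
          Complex.I * ((Real.exp (2 * x) : ℝ) *
            dbar g₂ (Complex.exp (x + y * Complex.I)))) : ℂ)).im =
        ∫ x : ℝ in Real.log ε..Real.log r, ∫ y : ℝ in (0)..(2 * Real.pi),
          Real.exp (2 * x) * (dbar g₂ (Complex.exp (x + y * Complex.I))).re := by
      rw [← Complex.imCLM_apply, ← ContinuousLinearMap.intervalIntegral_comp_comm]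
      · refine intervalIntegral.integral_congr fun x _ => ?_
        rw [← ContinuousLinearMap.intervalIntegral_comp_comm]
        · refine intervalIntegral.integral_congr fun y _ => ?_
          simp only [Complex.imCLM_apply, Complex.I_mul_im, Complex.re_ofReal_mul]
        · apply Continuous.intervalIntegrable
          exact (hcont g₂ hD2).comp (Continuous.prodMk_right x)
      · exact ((intervalIntegral.continuous_parametric_intervalIntegral_of_continuous' (hcont g₂ hD2)
          0 (2 * Real.pi)).intervalIntegrable _ _)
    rw [← h2]
    exact (le_abs_self _).trans (Complex.abs_im_le_norm _)
  have hlim : ∀ g : ℂ → ℂ, ContDiff ℝ 1 g →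
      Tendsto (fun ε : ℝ => ∮ z in C(0, ε), g z) (𝓝[>] 0) (𝓝 0) := by
    intro g hg
    obtain ⟨C, hC⟩ := (isCompact_closedBall (0 : ℂ) 1).exists_bound_of_continuousOn
      hg.continuous.continuousOn
    have h0 : Tendsto (fun ε : ℝ => 2 * Real.pi * ε * C) (𝓝[>] 0) (𝓝 0) := by
      have : Tendsto (fun ε : ℝ => 2 * Real.pi * ε * C) (𝓝 0) (𝓝 (2 * Real.pi * 0 * C)) := by
        apply Continuous.tendsto
        fun_prop
      simpa using this.mono_left nhdsWithin_le_nhds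
    refine squeeze_zero_norm' ?_ h0
    filter_upwards [Ioo_mem_nhdsGT (zero_lt_one' ℝ)] with ε hε
    refine circleIntegral.norm_integral_le_of_norm_le_const hε.1.le fun z hz => hC z ?_
    rw [mem_sphere_zero_iff_norm] at hz
    simp [hz, hε.2.le]
  have hl := (tendsto_const_nhds (x := ∮ z in C(0, r), g₁ z)).sub (hlim g₁ hg₁)
  have hl' := (tendsto_const_nhds (x := ∮ z in C(0, r), g₂ z)).sub (hlim g₂ hg₂)
  rw [sub_zero] at hl hl'
  refine le_of_tendsto_of_tendsto hl.norm hl'.norm ?_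
  filter_upwards [Ioo_mem_nhdsGT hr] with ε hε
  exact key ε hε.1 hε.2

theorem dbar_mul {u v : ℂ → ℂ} {z : ℂ} (hu : DifferentiableAt ℝ u z)
    (hv : DifferentiableAt ℝ v z) :
    dbar (fun w => u w * v w) z = u z * dbar v z + v z * dbar u z := by
  have h := hu.hasFDerivAt.fun_mul hv.hasFDerivAt
  simp only [dbar, h.fderiv, _root_.add_apply, _root_.smul_apply, smul_eq_mul]
  ring

theorem dbar_eq_zero {u : ℂ → ℂ} {z : ℂ} (hu : DifferentiableAt ℂ u z) : dbar u z = 0 := by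
  have h := hu.hasDerivAt.hasFDerivAt.restrictScalars ℝ
  simp only [dbar, h.fderiv, ContinuousLinearMap.coe_restrictScalars',
      ContinuousLinearMap.toSpanSingleton_apply, smul_eq_mul]
  linear_combination deriv u z * Complex.I_sq

theorem dbar_conj {u : ℂ → ℂ} {z : ℂ} (hu : DifferentiableAt ℂ u z) :
    dbar (fun w => (starRingEnd ℂ) (u w)) z = 2 * (starRingEnd ℂ) (deriv u z) := by
  have h : HasFDerivAt (fun w => (starRingEnd ℂ) (u w)) _ z :=
    (Complex.conjCLE.toContinuousLinearMap.hasFDerivAt).comp z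
      (hu.hasDerivAt.hasFDerivAt.restrictScalars ℝ)
  simp only [dbar, h.fderiv, ContinuousLinearMap.coe_restrictScalars',
    ContinuousLinearMap.comp_apply, ContinuousLinearEquiv.coe_coe, Complex.conjCLE_apply,
    ContinuousLinearMap.toSpanSingleton_apply, smul_eq_mul, map_mul, Complex.conj_I, map_one]
  linear_combination -(starRingEnd ℂ) (deriv u z) * Complex.I_sq

/-- If `h` is much smaller than `W` wherever `W` is small, then `h / W` is nearly orthogonal to
holomorphic functions on any circle on which `W` is bounded below. -/
theorem norm_circleIntegral_mul_div_le (W h φ : ℂ → ℂ) (hW : Differentiable ℂ W)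
    (hh : Differentiable ℂ h) (hφ : Differentiable ℂ φ) (r s τ s₁ B K : ℝ) (hr : 0 < r)
    (hr1 : r ≤ 1) (hs : 0 < s) (hs₁ : 0 < s₁) (hτ : 0 < τ)
    (hφK : ∀ z, ‖z‖ ≤ r → ‖φ z‖ ≤ K)
    (hsmall : ∀ z, ‖z‖ ≤ r → ‖h z‖ * s ≤ τ * (‖W z‖ ^ 2 + s ^ 2))
    (hWs : ∀ z, ‖z‖ = r → s₁ ≤ ‖W z‖) (hh1 : ∀ z, ‖z‖ = r → ‖h z‖ ≤ 1)
    (hWB : ∀ z, ‖z‖ = r → ‖deriv W z‖ ≤ B) :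
    ‖∮ z in C(0, r), φ z * (h z / W z)‖ ≤
      2 * Real.pi * (K * (s ^ 2 / s₁ ^ 3 + τ * (1 + B / s₁))) := by
  have hK : 0 ≤ K := (norm_nonneg _).trans (hφK 0 (by simpa using hr.le))
  have hB : 0 ≤ B := (norm_nonneg _).trans (hWB r (by simp [hr.le]))
  let q : ℂ → ℂ := fun z => W z * (starRingEnd ℂ) (W z) + (s : ℂ) ^ 2
  have hqr : ∀ z, q z = ((‖W z‖ ^ 2 + s ^ 2 : ℝ) : ℂ) := by
    intro z
    simp only [q, Complex.mul_conj, Complex.normSq_eq_norm_sq]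
    push_cast
    ring
  have hqpos : ∀ z, 0 < ‖W z‖ ^ 2 + s ^ 2 := fun z => by positivity
  have hqne : ∀ z, q z ≠ 0 := fun z => by
    rw [hqr]
    exact_mod_cast (hqpos z).ne'
  let V : ℂ → ℂ := fun z => (starRingEnd ℂ) (W z) / q z
  have hWc : ContDiff ℝ 1 W := hW.contDiff.restrict_scalars ℝ
  have hcW : ContDiff ℝ 1 fun z => (starRingEnd ℂ) (W z) := Complex.conjCLE.contDiff.comp hWc
  have hqc : ContDiff ℝ 1 q := (hWc.mul hcW).add contDiff_const
  have hVc : ContDiff ℝ 1 V := by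
    have := hcW.mul (hqc.inv hqne)
    simpa [V, div_eq_mul_inv] using this
  have hVd : ∀ z, DifferentiableAt ℝ V z := fun z => hVc.differentiable one_ne_zero z
  have hdbarV : ∀ z, dbar V z = 2 * (starRingEnd ℂ) (deriv W z) * (s : ℂ) ^ 2 / q z ^ 2 := by
    intro z
    have h1 : dbar (fun w => q w * V w) z = q z * dbar V z + V z * dbar q z :=
      dbar_mul (hqc.differentiable one_ne_zero z) (hVd z)
    have h2 : (fun w => q w * V w) = fun w => (starRingEnd ℂ) (W w) := by
      funext w
      exact mul_div_cancel₀ _ (hqne w)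
    have h3 : dbar q z = W z * (2 * (starRingEnd ℂ) (deriv W z)) := by
      have h4 : dbar q z = dbar (fun w => W w * (starRingEnd ℂ) (W w)) z := by
        simp only [dbar, q, fderiv_add_const]
      rw [h4, dbar_mul (hWc.differentiable one_ne_zero z) (hcW.differentiable one_ne_zero z),
        dbar_conj (hW z), dbar_eq_zero (hW z)]
      ring
    rw [h2, dbar_conj (hW z), h3] at h1
    have h5 : q z * V z = (starRingEnd ℂ) (W z) := mul_div_cancel₀ _ (hqne z)
    have h6 : q z = W z * (starRingEnd ℂ) (W z) + (s : ℂ) ^ 2 := rfl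
    rw [eq_div_iff (pow_ne_zero 2 (hqne z))]
    linear_combination (-q z) * h1 - 2 * W z * (starRingEnd ℂ) (deriv W z) * h5 +
      2 * (starRingEnd ℂ) (deriv W z) * h6
  have hφh : Differentiable ℂ fun z => φ z * h z := hφ.mul hh
  let g₁ : ℂ → ℂ := fun z => (φ z * h z) * V z
  let g₂ : ℂ → ℂ := fun z =>
    (K * τ / 2 : ℂ) * (starRingEnd ℂ) z + ((K * τ / 2 : ℂ) * deriv W z) * V z
  have hdW : Differentiable ℂ (deriv W) := hW.contDiff.differentiable_deriv_two
  have hKW : Differentiable ℂ fun z => (K * τ / 2 : ℂ) * deriv W z := hdW.const_mul _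
  have hg₁ : ContDiff ℝ 1 g₁ := (hφh.contDiff.restrict_scalars ℝ).mul hVc
  have hconj : ContDiff ℝ 1 fun z : ℂ => (K * τ / 2 : ℂ) * (starRingEnd ℂ) z :=
    contDiff_const.mul Complex.conjCLE.contDiff
  have hg₂' : ContDiff ℝ 1 fun z => ((K * τ / 2 : ℂ) * deriv W z) * V z :=
    (hKW.contDiff.restrict_scalars ℝ).mul hVc
  have hg₂ : ContDiff ℝ 1 g₂ := hconj.add hg₂'
  have hd₁ : ∀ z, dbar g₁ z = φ z * h z * dbar V z := by
    intro z
    rw [dbar_mul ((hφh z).restrictScalars ℝ) (hVd z), dbar_eq_zero (hφh z)]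
    ring
  have hd₂ : ∀ z, dbar g₂ z =
      ((K * τ * (1 + (‖deriv W z‖ * s / (‖W z‖ ^ 2 + s ^ 2)) ^ 2) : ℝ) : ℂ) := by
    intro z
    have h1 : dbar g₂ z = dbar (fun z : ℂ => (K * τ / 2 : ℂ) * (starRingEnd ℂ) z) z +
        dbar (fun z => ((K * τ / 2 : ℂ) * deriv W z) * V z) z := by
      have := fderiv_fun_add (hconj.differentiable one_ne_zero z) (hg₂'.differentiable one_ne_zero z)
      simp only [dbar, g₂, this, _root_.add_apply]
      ring
    have h2 : dbar (fun z : ℂ => (starRingEnd ℂ) z) z = 2 := by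
      have := dbar_conj (differentiableAt_id (𝕜 := ℂ) (x := z))
      simpa using this
    have h3 : (starRingEnd ℂ) (deriv W z) * deriv W z = ((‖deriv W z‖ ^ 2 : ℝ) : ℂ) := by
      rw [mul_comm, Complex.mul_conj, Complex.normSq_eq_norm_sq]
    have h4 : dbar (fun z : ℂ => (K * τ / 2 : ℂ) * (starRingEnd ℂ) z) z = K * τ := by
      have h6 : DifferentiableAt ℝ (fun z : ℂ => (starRingEnd ℂ) z) z :=
        Complex.conjCLE.differentiableAt
      rw [dbar_mul (differentiableAt_const _) h6, dbar_eq_zero (differentiableAt_const _), h2]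
      ring
    rw [h1, h4, dbar_mul ((hKW z).restrictScalars ℝ) (hVd z), dbar_eq_zero (hKW z), hdbarV,
      mul_zero, add_zero]
    have h5 : (K * τ / 2 : ℂ) * deriv W z * (2 * (starRingEnd ℂ) (deriv W z) * (s : ℂ) ^ 2 / q z ^ 2)
        = K * τ * ((starRingEnd ℂ) (deriv W z) * deriv W z) * (s : ℂ) ^ 2 / q z ^ 2 := by ring
    rw [h5, h3, hqr]
    generalize ‖W z‖ ^ 2 + s ^ 2 = Q
    push_cast
    ring
  have hcomp := norm_circleIntegral_le_of_dbar_le g₁ g₂ hg₁ hg₂ r hr (by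
    intro z hz
    rw [hd₂, Complex.ofReal_re, hd₁, hdbarV, hqr]
    set Q := ‖W z‖ ^ 2 + s ^ 2 with hQ
    have hQ0 : 0 < Q := hqpos z
    clear_value Q
    set y := ‖deriv W z‖ * s / Q with hy
    have hy0 : 0 ≤ y := by positivity
    have h1 : ‖φ z * h z * (2 * (starRingEnd ℂ) (deriv W z) * (s : ℂ) ^ 2 / (Q : ℂ) ^ 2)‖ =
        ‖φ z‖ * (‖h z‖ * s / Q) * (2 * y) := by
      simp only [norm_mul, norm_div, norm_pow, RCLike.norm_conj, Complex.norm_real,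
        Real.norm_eq_abs, abs_of_pos hs, abs_of_pos hQ0, Complex.norm_ofNat, hy]
      ring
    rw [h1]
    have h2 : ‖h z‖ * s / Q ≤ τ := by
      rw [div_le_iff₀ hQ0]
      exact hQ ▸ hsmall z hz
    calc ‖φ z‖ * (‖h z‖ * s / Q) * (2 * y) ≤ K * τ * (2 * y) := by
          gcongr
          exact hφK z hz
      _ ≤ K * τ * (1 + y ^ 2) := by
          gcongr
          nlinarith [sq_nonneg (y - 1)])
  have hVle : ∀ z, ‖z‖ = r → ‖V z‖ ≤ 1 / s₁ := by
    intro z hz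
    have hw := hWs z hz
    simp only [V]
    rw [norm_div, RCLike.norm_conj, hqr, Complex.norm_real, Real.norm_eq_abs, abs_of_pos (hqpos z),
      div_le_div_iff₀ (hqpos z) hs₁]
    nlinarith [sq_nonneg s]
  have hI₂ : ‖∮ z in C(0, r), g₂ z‖ ≤ 2 * Real.pi * r * (K * τ * (1 + B / s₁)) := by
    refine circleIntegral.norm_integral_le_of_norm_le_const hr.le fun z hz => ?_
    rw [mem_sphere_zero_iff_norm] at hz
    have h0 : ‖(K * τ / 2 : ℂ)‖ = K * τ / 2 := by
      simp [abs_of_nonneg hK, abs_of_pos hτ]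
    calc ‖g₂ z‖ ≤ ‖(K * τ / 2 : ℂ) * (starRingEnd ℂ) z‖ +
          ‖((K * τ / 2 : ℂ) * deriv W z) * V z‖ := norm_add_le _ _
      _ = K * τ / 2 * r + K * τ / 2 * ‖deriv W z‖ * ‖V z‖ := by
          simp only [norm_mul, h0, RCLike.norm_conj, hz]
      _ ≤ K * τ / 2 * 1 + K * τ / 2 * B * (1 / s₁) := by
          gcongr
          · exact hWB z hz
          · exact hVle z hz
      _ ≤ K * τ * (1 + B / s₁) := by
          have : 0 ≤ K * τ * (1 + B / s₁) := by positivity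
          have h2 : K * τ / 2 * 1 + K * τ / 2 * B * (1 / s₁) = K * τ * (1 + B / s₁) / 2 := by ring
          rw [h2]
          linarith
  have hWne : ∀ z, ‖z‖ = r → W z ≠ 0 := fun z hz => norm_pos_iff.mp (hs₁.trans_le (hWs z hz))
  have hI₁ : ‖∮ z in C(0, r), (φ z * (h z / W z) - g₁ z)‖ ≤
      2 * Real.pi * r * (K * (s ^ 2 / s₁ ^ 3)) := by
    refine circleIntegral.norm_integral_le_of_norm_le_const hr.le fun z hz => ?_
    rw [mem_sphere_zero_iff_norm] at hz
    have hne := hWne z hz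
    have h1 : φ z * (h z / W z) - g₁ z = φ z * h z * (s : ℂ) ^ 2 / (W z * q z) := by
      have h6 : q z = W z * (starRingEnd ℂ) (W z) + (s : ℂ) ^ 2 := rfl
      have := hqne z
      simp only [g₁, V]
      field_simp
      linear_combination φ z * h z * h6
    rw [h1, norm_div, norm_mul, norm_mul, norm_mul, norm_pow, hqr, Complex.norm_real,
      Complex.norm_real, Real.norm_eq_abs, Real.norm_eq_abs, abs_of_pos hs, abs_of_pos (hqpos z)]
    have hw := hWs z hz
    rw [mul_div_assoc']
    have h2 : s₁ ^ 3 ≤ ‖W z‖ * (‖W z‖ ^ 2 + s ^ 2) := by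
      have h3 : s₁ ^ 3 ≤ ‖W z‖ ^ 3 := by gcongr
      nlinarith [norm_nonneg (W z), sq_nonneg s, mul_nonneg (norm_nonneg (W z)) (sq_nonneg s)]
    have h4 : ‖φ z‖ * ‖h z‖ ≤ K * 1 :=
      mul_le_mul (hφK z hz.le) (hh1 z hz) (norm_nonneg _) hK
    rw [mul_one] at h4
    gcongr
  have hci : ∀ g : ℂ → ℂ, ContinuousOn g (Metric.sphere 0 r) → CircleIntegrable g 0 r :=
    fun g hg => hg.circleIntegrable hr.le
  have hsub : (∮ z in C(0, r), φ z * (h z / W z)) =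
      (∮ z in C(0, r), (φ z * (h z / W z) - g₁ z)) + ∮ z in C(0, r), g₁ z := by
    rw [circleIntegral.integral_sub _ (hci g₁ hg₁.continuous.continuousOn)]
    · exact (sub_add_cancel _ _).symm
    · refine hci _ (hφ.continuous.continuousOn.mul (hh.continuous.continuousOn.div
        hW.continuous.continuousOn fun z hz => hWne z ?_))
      exact mem_sphere_zero_iff_norm.mp hz
  rw [hsub]
  calc _ ≤ 2 * Real.pi * r * (K * (s ^ 2 / s₁ ^ 3)) + 2 * Real.pi * r * (K * τ * (1 + B / s₁)) :=
        (norm_add_le _ _).trans (add_le_add hI₁ (hcomp.trans hI₂))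
    _ = r * (2 * Real.pi * (K * (s ^ 2 / s₁ ^ 3 + τ * (1 + B / s₁)))) := by ring
    _ ≤ _ := mul_le_of_le_one_left (by positivity) hr1

theorem norm_dslope_le_of_norm_deriv_le {W : ℂ → ℂ} (hW : Differentiable ℂ W) {r B : ℝ}
    (hB : ∀ z, ‖z‖ ≤ r → ‖deriv W z‖ ≤ B) {z w : ℂ} (hz : ‖z‖ ≤ r) (hw : ‖w‖ ≤ r) :
    ‖dslope W z w‖ ≤ B := by
  rcases eq_or_ne w z with rfl | hne
  · rw [dslope_same]
    exact hB _ hw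
  · rw [dslope_of_ne _ hne, slope_def_field, norm_div,
      div_le_iff₀ (norm_pos_iff.mpr (sub_ne_zero.mpr hne))]
    exact (convex_closedBall (0 : ℂ) r).norm_image_sub_le_of_norm_deriv_le
      (fun x _ => hW x) (fun x hx => hB x (mem_closedBall_zero_iff.mp hx))
      (mem_closedBall_zero_iff.mpr hz) (mem_closedBall_zero_iff.mpr hw)

/-- If `h` is much smaller than `W` wherever `W` is small, then `h` is close to a holomorphic
multiple of `W`. -/
theorem exists_norm_sub_mul_le (W h : ℂ → ℂ) (hW : Differentiable ℂ W)
    (hh : Differentiable ℂ h) (r s τ s₁ B : ℝ) (hr : 0 < r)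
    (hr1 : r ≤ 1) (hs : 0 < s) (hs₁ : 0 < s₁) (hτ : 0 < τ)
    (hsmall : ∀ z, ‖z‖ ≤ r → ‖h z‖ * s ≤ τ * (‖W z‖ ^ 2 + s ^ 2))
    (hWs : ∀ z, ‖z‖ = r → s₁ ≤ ‖W z‖) (hh1 : ∀ z, ‖z‖ = r → ‖h z‖ ≤ 1)
    (hWB : ∀ z, ‖z‖ ≤ r → ‖deriv W z‖ ≤ B) :
    ∃ F : ℂ → ℂ, DifferentiableOn ℂ F (Metric.ball 0 r) ∧ ∀ z, ‖z‖ < r →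
      ‖h z - F z * W z‖ ≤ B * (s ^ 2 / s₁ ^ 3 + τ * (1 + B / s₁)) := by
  have hWne : ∀ z ∈ Metric.sphere (0 : ℂ) r, W z ≠ 0 := fun z hz =>
    norm_pos_iff.mp (hs₁.trans_le (hWs z (mem_sphere_zero_iff_norm.mp hz)))
  have hcont : ContinuousOn (fun z => h z / W z) (Metric.sphere 0 r) :=
    hh.continuous.continuousOn.div hW.continuous.continuousOn hWne
  let F : ℂ → ℂ := fun z => (2 * Real.pi * Complex.I : ℂ)⁻¹ • ∮ w in C(0, r), (w - z)⁻¹ • (h w / W w)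
  refine ⟨F, ?_, fun z hz => ?_⟩
  · have := hasFPowerSeriesOn_cauchy_integral (R := ⟨r, hr.le⟩) (f := fun z => h z / W z) (c := 0)
      (hcont.circleIntegrable hr.le) hr
    intro z hz
    refine (this.analyticAt_of_mem ?_).differentiableAt.differentiableWithinAt
    rw [mem_ball_zero_iff] at hz
    rw [Metric.mem_eball, edist_zero_right]
    have h2 : ‖z‖₊ < (⟨r, hr.le⟩ : NNReal) := hz
    exact ENNReal.coe_lt_coe.mpr h2
  · have hzb : z ∈ Metric.ball (0 : ℂ) r := mem_ball_zero_iff.mpr hz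
    have hcau : (2 * Real.pi * Complex.I : ℂ)⁻¹ • ∮ w in C(0, r), (w - z)⁻¹ • h w = h z :=
      hh.diffContOnCl.two_pi_i_inv_smul_circleIntegral_sub_inv_smul hzb
    have hne : ∀ w ∈ Metric.sphere (0 : ℂ) r, w - z ≠ 0 := by
      intro w hw h0
      rw [sub_eq_zero.mp h0, mem_sphere_zero_iff_norm] at hw
      exact hz.ne hw
    have hinv : ContinuousOn (fun w => (w - z)⁻¹) (Metric.sphere 0 r) :=
      (continuousOn_id.sub continuousOn_const).inv₀ hne
    have hds : Differentiable ℂ (dslope W z) := by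
      rw [← differentiableOn_univ] at hW ⊢
      exact (Complex.differentiableOn_dslope Filter.univ_mem).mpr hW
    have key : h z - F z * W z =
        (2 * Real.pi * Complex.I : ℂ)⁻¹ • ∮ w in C(0, r), dslope W z w * (h w / W w) := by
      have h1 : F z * W z = (2 * Real.pi * Complex.I : ℂ)⁻¹ •
          ∮ w in C(0, r), W z * ((w - z)⁻¹ • (h w / W w)) := by
        rw [circleIntegral.integral_const_mul]
        simp only [F, smul_eq_mul]
        ring
      rw [h1, ← hcau, ← smul_sub, ← circleIntegral.integral_sub]
      · congr 1
        refine circleIntegral.integral_congr hr.le fun w hw => ?_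
        have h2 := hne w hw
        have h3 := hWne w hw
        simp only [smul_eq_mul]
        rw [dslope_of_ne _ (sub_ne_zero.mp h2), slope_def_field]
        field_simp
      · exact (hinv.smul hh.continuous.continuousOn).circleIntegrable hr.le
      · exact (continuousOn_const.mul (hinv.smul hcont)).circleIntegrable hr.le
    have hb := norm_circleIntegral_mul_div_le W h (dslope W z) hW hh hds r s τ s₁ B B hr hr1 hs hs₁
      hτ (fun w hw => norm_dslope_le_of_norm_deriv_le hW hWB hz.le hw) hsmall hWs hh1
      (fun w hw => hWB w hw.le)
    have hpi : ‖(2 * Real.pi * Complex.I : ℂ)⁻¹‖ = (2 * Real.pi)⁻¹ := by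
      simp [abs_of_pos Real.pi_pos]
    rw [key, norm_smul, hpi, inv_mul_le_iff₀ (by positivity)]
    exact hb

theorem norm_pow_sub_pow_le_of_norm_le {x y : ℂ} {R : ℝ} (hR : 1 ≤ R) (hx : ‖x‖ ≤ R) (hy : ‖y‖ ≤ R)
    (k : ℕ) : ‖x ^ k - y ^ k‖ ≤ k * R ^ k * ‖x - y‖ := by
  induction k with
  | zero => simp
  | succ k ih =>
    have h1 : x ^ (k + 1) - y ^ (k + 1) = x * (x ^ k - y ^ k) + (x - y) * y ^ k := by ring
    have h2 : ‖y‖ ^ k ≤ R ^ k * R := (pow_le_pow_left₀ (norm_nonneg _) hy k).trans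
      (le_mul_of_one_le_right (by positivity) hR)
    calc ‖x ^ (k + 1) - y ^ (k + 1)‖ ≤ ‖x‖ * ‖x ^ k - y ^ k‖ + ‖x - y‖ * ‖y‖ ^ k := by
          rw [h1, ← norm_pow, ← norm_mul, ← norm_mul]
          exact norm_add_le _ _
      _ ≤ R * (k * R ^ k * ‖x - y‖) + ‖x - y‖ * (R ^ k * R) := by gcongr
      _ = ((k + 1 : ℕ) : ℝ) * R ^ (k + 1) * ‖x - y‖ := by
          push_cast
          ring

theorem mul_pow_le_of_pow_le {h u t τ : ℝ} {p b : ℕ} (hp : p ≠ 0) (hb : b ≠ 0) (hu : 0 ≤ u)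
    (ht : 0 < t) (hτ : 0 ≤ τ) (htτ : 2 * t = τ ^ p)
    (hpow : h ^ p ≤ u ^ (b * p + 1) + t ^ (b * p + 1)) :
    h * t ^ b ≤ τ * ((u ^ b) ^ 2 + (t ^ b) ^ 2) := by
  obtain ⟨m, hm⟩ : ∃ m, b * p = m + 1 := Nat.exists_eq_succ_of_ne_zero (mul_ne_zero hb hp)
  rcases le_total u t with hut | hut
  · have h1 : h ^ p ≤ (τ * t ^ b) ^ p := by
      have : u ^ (b * p + 1) ≤ t ^ (b * p + 1) := pow_le_pow_left₀ hu hut _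
      rw [mul_pow, ← htτ, ← pow_mul]
      calc h ^ p ≤ t ^ (b * p + 1) + t ^ (b * p + 1) := by linarith
        _ = 2 * t * t ^ (b * p) := by ring
    have h2 : h ≤ τ * t ^ b := le_of_pow_le_pow_left₀ hp (by positivity) h1
    calc h * t ^ b ≤ τ * t ^ b * t ^ b := by gcongr
      _ = τ * (t ^ b) ^ 2 := by ring
      _ ≤ _ := by
        gcongr
        linarith [sq_nonneg (u ^ b)]
  · have h1 : (h * t ^ b) ^ p ≤ (τ * (u ^ b) ^ 2) ^ p := by
      rw [mul_pow, mul_pow, ← htτ, ← pow_mul, ← pow_mul, ← pow_mul]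
      have e1 : b * (2 * p) = (m + 1) + (m + 1) := by rw [← hm]; ring
      rw [e1, hm]
      rw [hm] at hpow
      have h3 : t ^ m ≤ u ^ m := pow_le_pow_left₀ ht.le hut m
      have h4 : t ^ (m + 1) ≤ u ^ (m + 1) := pow_le_pow_left₀ ht.le hut _
      have hum : 0 ≤ u ^ (m + 1) := by positivity
      have htm : 0 ≤ t ^ (m + 1) := by positivity
      calc h ^ p * t ^ (m + 1) ≤ (u ^ (m + 1 + 1) + t ^ (m + 1 + 1)) * t ^ (m + 1) := by gcongr
        _ = t * (u ^ (m + 1) * (u * t ^ m) + t ^ (m + 1) * t ^ (m + 1)) := by ring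
        _ ≤ t * (u ^ (m + 1) * (u * u ^ m) + u ^ (m + 1) * u ^ (m + 1)) := by gcongr
        _ = 2 * t * u ^ (m + 1 + (m + 1)) := by ring
    have h2 : h * t ^ b ≤ τ * (u ^ b) ^ 2 := le_of_pow_le_pow_left₀ hp (by positivity) h1
    refine h2.trans ?_
    gcongr
    linarith [sq_nonneg (t ^ b)]

/-- A bounded holomorphic function is exponentially well approximated by its Taylor polynomials
near the centre. -/
theorem exists_polynomial_norm_sub_le {F : ℂ → ℂ} {R E C : ℝ} (hR : 0 < R) (hE : 0 < E)
    (hE1 : E ≤ 1) (hF : DiffContOnCl ℂ F (Metric.ball 0 R)) (hC : ∀ z, ‖z‖ ≤ R → ‖F z‖ ≤ C)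
    (n : ℕ) : ∃ P : Polynomial ℂ, P.natDegree ≤ n ∧
      ∀ z, ‖z‖ ≤ R * (E / 2) → ‖P.eval z - F z‖ ≤ C * E ^ n := by
  have hC0 : 0 ≤ C := (norm_nonneg _).trans (hC 0 (by simpa using hR.le))
  let c : ℕ → ℂ := fun k => (k.factorial : ℂ)⁻¹ * iteratedDeriv k F 0
  have hc : ∀ k, ‖c k‖ ≤ C / R ^ k := by
    intro k
    have h1 := Complex.norm_iteratedDeriv_le_of_forall_mem_sphere_norm_le k hR hF
      (fun z hz => hC z (mem_sphere_zero_iff_norm.mp hz).le)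
    have h2 : (0 : ℝ) < k.factorial := by exact_mod_cast k.factorial_pos
    rw [norm_mul, norm_inv, Complex.norm_natCast]
    rw [inv_mul_le_iff₀ h2, ← mul_div_assoc]
    exact h1
  refine ⟨∑ k ∈ Finset.range (n + 1), Polynomial.monomial k (c k), ?_, fun z hz => ?_⟩
  · refine Polynomial.natDegree_sum_le_of_forall_le _ _ fun k hk => ?_
    exact (Polynomial.natDegree_monomial_le _).trans (Nat.lt_succ_iff.mp (Finset.mem_range.mp hk))
  · have hzR : z ∈ Metric.ball (0 : ℂ) R := by
      rw [mem_ball_zero_iff]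
      nlinarith
    have hsum : HasSum (fun k => c k * z ^ k) (F z) := by
      have := Complex.hasSum_taylorSeries_on_ball hF.differentiableOn hzR
      have h4 : ∀ k, c k * z ^ k =
          (k.factorial : ℂ)⁻¹ • (z - 0) ^ k • iteratedDeriv k F 0 := fun k => by
        simp only [c, sub_zero, smul_eq_mul]
        ring
      simpa only [h4] using this
    have htail := (hasSum_nat_add_iff' (n + 1)).mpr hsum
    have hgeo : HasSum (fun k => C * (E / 2) ^ (n + 1) * (1 / 2 : ℝ) ^ k)
        (C * (E / 2) ^ (n + 1) * 2) := hasSum_geometric_two.mul_left _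
    have hle := htail.norm_le_of_bounded hgeo fun k => by
      rw [norm_mul, norm_pow]
      calc ‖c (k + (n + 1))‖ * ‖z‖ ^ (k + (n + 1))
          ≤ C / R ^ (k + (n + 1)) * (R * (E / 2)) ^ (k + (n + 1)) := by
            gcongr
            exact hc _
        _ = C * (E / 2) ^ (n + 1) * (E / 2) ^ k := by
            rw [mul_pow, div_mul_eq_mul_div, div_eq_iff (by positivity), pow_add (E / 2)]
            ring
        _ ≤ C * (E / 2) ^ (n + 1) * (1 / 2) ^ k := by gcongr
    rw [norm_sub_rev, Polynomial.eval_finsetSum]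
    simp only [Polynomial.eval_monomial]
    refine hle.trans ?_
    have h3 : (E / 2) ^ (n + 1) * 2 ≤ E ^ n := by
      rw [pow_succ]
      have : (E / 2) ^ n ≤ E ^ n := by
        gcongr
        linarith
      nlinarith [pow_pos hE n, pow_pos (half_pos hE) n]
    calc C * (E / 2) ^ (n + 1) * 2 = C * ((E / 2) ^ (n + 1) * 2) := by ring
      _ ≤ C * E ^ n := by gcongr

theorem norm_eval_pow_sub_eval_pow_le (f : ℝ → ℂ) (p q n : ℕ) (G H : Polynomial ℂ)
    (hG : G.natDegree ≤ n) (hH : H.natDegree ≤ n) (δ : ℝ) (hδ1 : δ ≤ 1)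
    (hG1 : ∀ z, ‖z‖ ≤ 1 → ‖G.eval z‖ ≤ 1) (hH1 : ∀ z, ‖z‖ ≤ 1 → ‖H.eval z‖ ≤ 1)
    (hfG : ∀ x : ℝ, |x| ≤ 1 → ‖f x ^ p - G.eval (x : ℂ)‖ ≤ δ)
    (hfH : ∀ x : ℝ, |x| ≤ 1 → ‖f x ^ q - H.eval (x : ℂ)‖ ≤ δ) (z : ℂ) (hz : ‖z‖ ≤ 1) :
    ‖G.eval z ^ q - H.eval z ^ p‖ ≤ (q * 2 ^ q + p * 2 ^ p) * δ * 3 ^ (n * (p + q)) := by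
  have hδ0 : 0 ≤ δ := (norm_nonneg _).trans (hfG 0 (by simp))
  have hdeg : (G ^ q - H ^ p).natDegree ≤ n * (p + q) := by
    refine (Polynomial.natDegree_sub_le _ _).trans (max_le ?_ ?_)
    · refine Polynomial.natDegree_pow_le.trans ?_
      nlinarith [Nat.mul_le_mul_left q hG]
    · refine Polynomial.natDegree_pow_le.trans ?_
      nlinarith [Nat.mul_le_mul_left p hH]
  have hreal : ∀ x : ℝ, |x| ≤ 1 →
      ‖(G ^ q - H ^ p).eval (x : ℂ)‖ ≤ (q * 2 ^ q + p * 2 ^ p) * δ := by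
    intro x hx
    have hxc : ‖(x : ℂ)‖ ≤ 1 := by simpa using hx
    have hbd : ∀ (u : ℂ) (v : ℂ), ‖v‖ ≤ 1 → ‖u - v‖ ≤ δ → ‖u‖ ≤ 2 := by
      intro u v hv huv
      have := norm_le_norm_add_norm_sub' u v
      linarith
    have h1 := norm_pow_sub_pow_le_of_norm_le one_le_two
      ((hG1 x hxc).trans one_le_two) (hbd _ _ (hG1 x hxc) (hfG x hx)) q
    have h2 := norm_pow_sub_pow_le_of_norm_le one_le_two
      (hbd _ _ (hH1 x hxc) (hfH x hx)) ((hH1 x hxc).trans one_le_two) p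
    rw [norm_sub_rev (G.eval (x : ℂ)) (f x ^ p)] at h1
    have h3 : (G ^ q - H ^ p).eval (x : ℂ) =
        (G.eval (x : ℂ) ^ q - (f x ^ p) ^ q) + ((f x ^ q) ^ p - H.eval (x : ℂ) ^ p) := by
      rw [Polynomial.eval_sub, Polynomial.eval_pow, Polynomial.eval_pow]
      ring
    rw [h3]
    calc _ ≤ q * 2 ^ q * ‖f x ^ p - G.eval (x : ℂ)‖ + p * 2 ^ p * ‖f x ^ q - H.eval (x : ℂ)‖ :=
          (norm_add_le _ _).trans (add_le_add h1 h2)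
      _ ≤ q * 2 ^ q * δ + p * 2 ^ p * δ := by
          gcongr
          · exact hfG x hx
          · exact hfH x hx
      _ = _ := by ring
  have := norm_eval_le_of_norm_le_on_unit_interval _ _ hdeg _ hreal z
  rw [Polynomial.eval_sub, Polynomial.eval_pow, Polynomial.eval_pow] at this
  refine this.trans ?_
  gcongr
  linarith

set_option maxHeartbeats 1000000 in
theorem exists_holomorphic_approx (f : ℝ → ℂ) (p q a b n : ℕ) (hp : p ≠ 0) (ha : a ≠ 0)
    (hb : b ≠ 0) (hab : a * q = b * p + 1) (G H : Polynomial ℂ) (hGn : G.natDegree ≤ n)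
    (hG : ∀ z, ‖z‖ ≤ 2 → ‖G.eval z‖ ≤ 1)
    (hH : ∀ z, ‖z‖ ≤ 2 → ‖H.eval z‖ ≤ 1) (δ δ₁ e τ t s₁ : ℝ) (he : 0 < e) (he1 : e ≤ 1)
    (hfG : ∀ x : ℝ, |x| ≤ 1 → ‖f x ^ p - G.eval (x : ℂ)‖ ≤ δ)
    (hfH : ∀ x : ℝ, |x| ≤ 1 → ‖f x ^ q - H.eval (x : ℂ)‖ ≤ δ)
    (hGH : ∀ z, ‖z‖ ≤ 1 → ‖G.eval z ^ q - H.eval z ^ p‖ ≤ δ₁) (hδ : δ ≤ δ₁)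
    (hτ : 0 < τ) (hτ1 : τ ≤ 1) (ht : 2 * t = τ ^ p) (hδ₁ : a * δ₁ ≤ t ^ (b * p + 1))
    (hs₁ : s₁ = (e ^ p / 2 * (1 / 256) ^ n) ^ b)
    (hτs : (p * 2 ^ p * 3 + 3 + 2 * b * 2 ^ b + a * 2 ^ a) * τ ≤ s₁ ^ (p + 3) * e ^ (b * p + p)) :
    ∃ F : ℂ → ℂ, DiffContOnCl ℂ F (Metric.ball 0 (1 / 8)) ∧ (∀ z, ‖z‖ ≤ 1 / 8 → ‖F z‖ ≤ 2) ∧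
      ∀ x : ℝ, |x| ≤ 1 / 8 → ‖F x - f x‖ ≤ 3 * e := by
  have hpe : 0 < e ^ p := by positivity
  have hpe1 : e ^ p ≤ 1 := pow_le_one₀ he.le he1
  have hs₁0 : 0 < s₁ := by rw [hs₁]; positivity
  have hs₁1 : s₁ ≤ 1 := by
    rw [hs₁]
    refine pow_le_one₀ (by positivity) ?_
    have : (1 / 256 : ℝ) ^ n ≤ 1 := pow_le_one₀ (by norm_num) (by norm_num)
    nlinarith [pow_pos (show (0 : ℝ) < 1 / 256 by norm_num) n]
  have ht0 : 0 < t := by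
    have : 0 < τ ^ p := by positivity
    linarith
  have htτ : 2 * t ≤ τ := by
    rw [ht]
    exact pow_le_of_le_one hτ.le hτ1 hp
  have hδ0 : 0 ≤ δ := (norm_nonneg _).trans (hfG 0 (by simp))
  have ha1 : (1 : ℝ) ≤ a := by exact_mod_cast Nat.one_le_iff_ne_zero.mpr ha
  have haδ : a * δ₁ ≤ t := hδ₁.trans (pow_le_of_le_one ht0.le (by linarith) (Nat.succ_ne_zero _))
  have hδ₁t : δ₁ ≤ t := (le_mul_of_one_le_left (hδ0.trans hδ) ha1).trans haδ
  have hδt : δ ≤ t := hδ.trans hδ₁t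
  have hp2 : 0 ≤ (p : ℝ) * 2 ^ p := by positivity
  have hb2 : 0 ≤ (b : ℝ) * 2 ^ b := by positivity
  have ha2 : 0 ≤ (a : ℝ) * 2 ^ a := by positivity
  have hesplit : e ^ (b * p + p) ≤ e ^ p := pow_le_pow_of_le_one he.le he1 (by omega)
  have hs₁3 : s₁ ^ (p + 3) ≤ s₁ ^ 3 := pow_le_pow_of_le_one hs₁0.le hs₁1 (by omega)
  have hs₁p1 : s₁ ^ (p + 3) ≤ 1 := pow_le_one₀ hs₁0.le hs₁1
  have h3τ : 3 * τ ≤ e ^ p := by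
    have : s₁ ^ (p + 3) * e ^ (b * p + p) ≤ 1 * e ^ p := by gcongr
    nlinarith
  by_cases hcase : ∀ z, ‖z‖ ≤ 1 → ‖G.eval z‖ ≤ e ^ p / 2
  · refine ⟨fun _ => 0, diffContOnCl_const, fun _ _ => by simp, fun x hx => ?_⟩
    have hx1 : |x| ≤ 1 := hx.trans (by norm_num)
    have h1 : ‖f x‖ ^ p ≤ e ^ p := by
      rw [← norm_pow]
      have h2 := norm_le_norm_add_norm_sub' (f x ^ p) (G.eval (x : ℂ))
      have h3 := hfG x hx1
      have h4 := hcase x (by simpa using hx1)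
      linarith
    have h2 : ‖f x‖ ≤ e := le_of_pow_le_pow_left₀ hp he.le h1
    rw [zero_sub, norm_neg]
    linarith
  push Not at hcase
  obtain ⟨z₀, hz₀, hGz₀⟩ := hcase
  have hG1 : ∀ z, ‖z‖ ≤ 1 → ‖G.eval z‖ ≤ 1 := fun z hz => hG z (hz.trans one_le_two)
  have hH1 : ∀ z, ‖z‖ ≤ 1 → ‖H.eval z‖ ≤ 1 := fun z hz => hH z (hz.trans one_le_two)
  let W : ℂ → ℂ := fun z => G.eval z ^ b
  let h : ℂ → ℂ := fun z => H.eval z ^ a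
  have hWd : Differentiable ℂ W := G.differentiable.pow b
  have hhd : Differentiable ℂ h := H.differentiable.pow a
  have hW1 : ∀ z, ‖z‖ ≤ 2 → ‖W z‖ ≤ 1 := fun z hz => by
    simp only [W, norm_pow]
    exact pow_le_one₀ (norm_nonneg _) (hG z hz)
  have hh1 : ∀ z, ‖z‖ ≤ 1 → ‖h z‖ ≤ 1 := fun z hz => by
    simp only [h, norm_pow]
    exact pow_le_one₀ (norm_nonneg _) (hH1 z hz)
  have hpowsub : ∀ z, ‖z‖ ≤ 1 → ‖h z ^ p - G.eval z * W z ^ p‖ ≤ a * δ₁ := by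
    intro z hz
    have h1 : h z ^ p - G.eval z * W z ^ p = (H.eval z ^ p) ^ a - (G.eval z ^ q) ^ a := by
      have : G.eval z * W z ^ p = G.eval z ^ (a * q) := by
        rw [hab]
        simp only [W]
        ring
      rw [this]
      simp only [h]
      ring
    have h2 := norm_pow_sub_pow_le_of_norm_le (x := H.eval z ^ p) (y := G.eval z ^ q) le_rfl
      (by rw [norm_pow]; exact pow_le_one₀ (norm_nonneg _) (hH1 z hz))
      (by rw [norm_pow]; exact pow_le_one₀ (norm_nonneg _) (hG1 z hz)) a
    rw [one_pow, mul_one, norm_sub_rev (H.eval z ^ p)] at h2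
    rw [h1]
    exact h2.trans (by gcongr; exact hGH z hz)
  have hcirc : ∀ c ρ : ℝ, 1 / 16 ≤ ρ → 0 ≤ c - ρ → c + ρ ≤ 1 →
      ∃ r, |r - c| ≤ ρ ∧ ∀ z, ‖z‖ = r → s₁ ≤ ‖W z‖ := by
    intro c ρ hρ hc hc'
    obtain ⟨r, hr, hrG⟩ := exists_circle_norm_eval_ge G n hGn z₀ hz₀ c ρ (by linarith) hc hc'
    refine ⟨r, hr, fun z hz => ?_⟩
    simp only [W, norm_pow, hs₁]
    have h1 : (1 / 256 : ℝ) ≤ ρ / 16 := by linarith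
    refine pow_le_pow_left₀ (by positivity) (le_trans ?_ (hrG z hz)) b
    gcongr
  obtain ⟨r, hrabs, hrW⟩ := hcirc (3 / 4) (1 / 4) (by norm_num) (by norm_num) (by norm_num)
  obtain ⟨r', hrabs', hrW'⟩ := hcirc (3 / 16) (1 / 16) (by norm_num) (by norm_num) (by norm_num)
  rw [abs_le] at hrabs hrabs'
  have hr1 : r ≤ 1 := by linarith
  have hr2 : 1 / 2 ≤ r := by linarith
  have hr1' : r' ≤ 1 / 4 := by linarith
  have hr2' : 1 / 8 ≤ r' := by linarith
  have hsmall : ∀ z, ‖z‖ ≤ r → ‖h z‖ * t ^ b ≤ τ * (‖W z‖ ^ 2 + (t ^ b) ^ 2) := by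
    intro z hz
    have hz1 := hz.trans hr1
    have h1 : ‖h z‖ ^ p ≤ ‖G.eval z‖ ^ (b * p + 1) + t ^ (b * p + 1) := by
      have h2 := norm_le_norm_add_norm_sub' (h z ^ p) (G.eval z * W z ^ p)
      have h3 : ‖G.eval z * W z ^ p‖ = ‖G.eval z‖ ^ (b * p + 1) := by
        simp only [W, norm_mul, norm_pow]
        ring
      rw [h3, norm_pow] at h2
      linarith [hpowsub z hz1]
    have := mul_pow_le_of_pow_le hp hb (norm_nonneg _) ht0 hτ.le ht h1
    simpa only [W, norm_pow] using this
  have hWB : ∀ z, ‖z‖ ≤ r → ‖deriv W z‖ ≤ 1 := by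
    intro z hz
    have := Complex.norm_deriv_le_of_forall_mem_sphere_norm_le (c := z) (C := 1) one_pos
      hWd.diffContOnCl (fun w hw => hW1 w (by
        rw [mem_sphere_iff_norm] at hw
        have := norm_le_norm_add_norm_sub' w z
        linarith))
    simpa using this
  obtain ⟨F, hFd, hF⟩ := exists_norm_sub_mul_le W h hWd hhd r (t ^ b) τ s₁ 1 (by linarith) hr1
    (by positivity) hs₁0 hτ hsmall hrW (fun z hz => hh1 z (hz.le.trans hr1)) hWB
  set η := 3 * τ / s₁ ^ 3 with hη
  have hη0 : 0 ≤ η := by positivity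
  have hFη : ∀ z, ‖z‖ < r → ‖h z - F z * W z‖ ≤ η := by
    intro z hz
    refine (hF z hz).trans ?_
    have h1 : (t ^ b) ^ 2 ≤ τ := by
      have : (t ^ b) ^ 2 ≤ t := by
        rw [← pow_mul]
        exact pow_le_of_le_one ht0.le (by linarith) (mul_ne_zero hb two_ne_zero)
      linarith
    have h2 : s₁ ^ 3 ≤ 1 := pow_le_one₀ hs₁0.le hs₁1
    have h3 : s₁ ^ 3 ≤ s₁ := pow_le_of_le_one hs₁0.le hs₁1 (by norm_num)
    have h4 : (t ^ b) ^ 2 / s₁ ^ 3 ≤ τ / s₁ ^ 3 := by gcongr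
    have h5 : τ ≤ τ / s₁ ^ 3 := by
      rw [le_div_iff₀ (by positivity)]
      exact mul_le_of_le_one_right hτ.le h2
    have h6 : τ / s₁ ≤ τ / s₁ ^ 3 := by gcongr
    have h7 : τ * (1 + 1 / s₁) = τ + τ / s₁ := by ring
    have h8 : η = τ / s₁ ^ 3 + τ / s₁ ^ 3 + τ / s₁ ^ 3 := by rw [hη]; ring
    rw [one_mul, h7, h8]
    linarith
  have hs₁3pos : 0 < s₁ ^ 3 := by positivity
  have hη1 : η ≤ 1 := by
    rw [hη, div_le_one hs₁3pos]
    have : s₁ ^ (p + 3) * e ^ (b * p + p) ≤ s₁ ^ 3 * 1 := by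
      gcongr
      exact hesplit.trans hpe1
    nlinarith
  have hη₂ : (p * 2 ^ p * η + a * δ₁) / s₁ ^ p + δ ≤ e ^ p := by
    have h1 : s₁ ^ (p + 3) = s₁ ^ p * s₁ ^ 3 := by ring
    have hsp : 0 < s₁ ^ p := by positivity
    have hsp1 : s₁ ^ p ≤ 1 := pow_le_one₀ hs₁0.le hs₁1
    have hs31 : s₁ ^ 3 ≤ 1 := pow_le_one₀ hs₁0.le hs₁1
    have h2 : (p * 2 ^ p * η + a * δ₁) / s₁ ^ p + δ ≤ (p * 2 ^ p * 3 + 3) * τ / s₁ ^ (p + 3) := by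
      rw [le_div_iff₀ (by positivity), h1]
      have h3 : ((p * 2 ^ p * η + a * δ₁) / s₁ ^ p + δ) * (s₁ ^ p * s₁ ^ 3) =
          p * 2 ^ p * (η * s₁ ^ 3) + a * δ₁ * s₁ ^ 3 + δ * (s₁ ^ p * s₁ ^ 3) := by
        field_simp
      have h4 : η * s₁ ^ 3 = 3 * τ := div_mul_cancel₀ _ hs₁3pos.ne'
      have h5 : a * δ₁ * s₁ ^ 3 ≤ t * 1 := by gcongr
      have h6 : δ * (s₁ ^ p * s₁ ^ 3) ≤ t * 1 := by
        rw [← h1]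
        gcongr
      rw [h3, h4]
      linarith
    refine h2.trans ?_
    rw [div_le_iff₀ (by positivity), mul_comm (e ^ p)]
    refine le_trans ?_ (hτs.trans (by gcongr))
    exact mul_le_mul_of_nonneg_right (by linarith) hτ.le
  have hη₃ : 2 * (b * 2 ^ b * δ) + η + a * 2 ^ a * δ ≤ e * e ^ (b * p) := by
    have h2 : 2 * (b * 2 ^ b * δ) + η + a * 2 ^ a * δ ≤
        (3 + 2 * b * 2 ^ b + a * 2 ^ a) * τ / s₁ ^ 3 := by
      rw [le_div_iff₀ hs₁3pos]
      have h4 : η * s₁ ^ 3 = 3 * τ := div_mul_cancel₀ _ hs₁3pos.ne'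
      have h5 : δ * s₁ ^ 3 ≤ τ := by
        have : δ * s₁ ^ 3 ≤ t * 1 := by
          gcongr
          exact pow_le_one₀ hs₁0.le hs₁1
        linarith
      have h6 : (2 * (b * 2 ^ b * δ) + η + a * 2 ^ a * δ) * s₁ ^ 3 =
        2 * (b * 2 ^ b) * (δ * s₁ ^ 3) + η * s₁ ^ 3 + a * 2 ^ a * (δ * s₁ ^ 3) := by ring
      rw [h6, h4]
      have h7 := mul_le_mul_of_nonneg_left h5 hb2
      have h8 := mul_le_mul_of_nonneg_left h5 ha2
      linarith
    refine h2.trans ?_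
    rw [div_le_iff₀ hs₁3pos, mul_comm]
    rw [mul_comm] at hτs
    have h9 : e ^ (b * p + p) ≤ e * e ^ (b * p) := by
      rw [pow_add, mul_comm]
      gcongr
      exact pow_le_of_le_one he.le he1 hp
    calc τ * (3 + 2 * b * 2 ^ b + a * 2 ^ a)
        ≤ τ * (p * 2 ^ p * 3 + 3 + 2 * b * 2 ^ b + a * 2 ^ a) := by
          gcongr
          linarith
      _ ≤ s₁ ^ (p + 3) * e ^ (b * p + p) := hτs
      _ ≤ s₁ ^ 3 * (e * e ^ (b * p)) := by gcongr
      _ = _ := by ring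
  have hdisc : ∀ z, ‖z‖ ≤ r' → ‖F z ^ p - G.eval z‖ ≤ (p * 2 ^ p * η + a * δ₁) / s₁ ^ p := by
    have hsub : Metric.closedBall (0 : ℂ) r' ⊆ Metric.ball 0 r :=
      Metric.closedBall_subset_ball (by linarith)
    have hdiff : DiffContOnCl ℂ (fun z => F z ^ p - G.eval z) (Metric.ball 0 r') :=
      (((hFd.mono hsub).pow p).sub G.differentiable.differentiableOn).diffContOnCl_ball subset_rfl
    intro z hz
    refine Complex.norm_le_of_forall_mem_frontier_norm_le Metric.isBounded_ball hdiff
      (fun w hw => ?_) (z := z) ?_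
    · have hwr : ‖w‖ = r' := mem_sphere_zero_iff_norm.mp (Metric.frontier_ball_subset_sphere hw)
      have hw1 : ‖w‖ ≤ 1 := by linarith
      have h1 := hFη w (by linarith)
      have h2 : ‖F w * W w‖ ≤ 2 := by
        have := norm_le_norm_add_norm_sub (h w) (F w * W w)
        linarith [hh1 w hw1]
      have h3 := norm_pow_sub_pow_le_of_norm_le one_le_two h2
        ((hh1 w hw1).trans one_le_two) p
      rw [norm_sub_rev (F w * W w)] at h3
      have h4 : (F w ^ p - G.eval w) * W w ^ p =
          ((F w * W w) ^ p - h w ^ p) + (h w ^ p - G.eval w * W w ^ p) := by ring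
      have h5 : ‖F w ^ p - G.eval w‖ * ‖W w‖ ^ p ≤ p * 2 ^ p * η + a * δ₁ := by
        rw [← norm_pow, ← norm_mul, h4]
        refine (norm_add_le _ _).trans (add_le_add (h3.trans ?_) (hpowsub w hw1))
        gcongr
      rw [le_div_iff₀ (by positivity)]
      refine le_trans ?_ h5
      gcongr
      exact hrW' w hwr
    · rw [closure_ball _ (by linarith)]
      exact mem_closedBall_zero_iff.mpr hz
  have hF2 : ∀ z, ‖z‖ ≤ 1 / 8 → ‖F z‖ ≤ 2 := by
    intro z hz
    have h1 := hdisc z (by linarith)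
    have h2 : ‖F z‖ ^ p ≤ 2 := by
      rw [← norm_pow]
      have := norm_le_norm_add_norm_sub' (F z ^ p) (G.eval z)
      linarith [hG1 z (by linarith)]
    refine le_of_pow_le_pow_left₀ hp (by norm_num) (h2.trans ?_)
    exact le_self_pow₀ one_le_two hp
  refine ⟨F, (hFd.mono (Metric.closedBall_subset_ball (by linarith))).diffContOnCl_ball subset_rfl,
    hF2, fun x hx => ?_⟩
  have hx1 : |x| ≤ 1 := hx.trans (by norm_num)
  have hxn : ‖(x : ℂ)‖ = |x| := by simp
  have hδ1 : δ ≤ 1 := by linarith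
  have hfp2 : ‖f x ^ p‖ ≤ 2 := by
    have := norm_le_norm_add_norm_sub' (f x ^ p) (G.eval (x : ℂ))
    linarith [hG1 x (hxn.trans_le hx1), hfG x hx1]
  have hfq2 : ‖f x ^ q‖ ≤ 2 := by
    have := norm_le_norm_add_norm_sub' (f x ^ q) (H.eval (x : ℂ))
    linarith [hH1 x (hxn.trans_le hx1), hfH x hx1]
  have hmain : ‖f x‖ ^ (b * p) * ‖F x - f x‖ ≤ e * e ^ (b * p) := by
    have h1 : f x ^ (b * p) * (F x - f x) = F x * ((f x ^ p) ^ b - G.eval (x : ℂ) ^ b) +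
        (F x * W x - h x) + (H.eval (x : ℂ) ^ a - (f x ^ q) ^ a) := by
      have h2 : (f x ^ q) ^ a = f x ^ (b * p) * f x := by
        rw [← pow_succ, ← hab]
        ring
      rw [h2]
      simp only [W, h]
      ring
    have h2 := norm_pow_sub_pow_le_of_norm_le one_le_two hfp2
      ((hG1 x (hxn.trans_le hx1)).trans one_le_two) b
    have h3 := norm_pow_sub_pow_le_of_norm_le one_le_two
      ((hH1 x (hxn.trans_le hx1)).trans one_le_two) hfq2 a
    have h4 := hFη x (by rw [hxn]; linarith)
    rw [norm_sub_rev] at h4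
    rw [norm_sub_rev (H.eval (x : ℂ))] at h3
    rw [← norm_pow, ← norm_mul, h1]
    refine le_trans ?_ hη₃
    refine (norm_add₃_le).trans ?_
    rw [norm_mul]
    gcongr
    · exact hF2 x (hxn.trans_le hx)
    · exact h2.trans (by gcongr; exact hfG x hx1)
    · exact h3.trans (by gcongr; exact hfH x hx1)
  rcases le_total e ‖f x‖ with hef | hef
  · have h1 : e ^ (b * p) * ‖F x - f x‖ ≤ e ^ (b * p) * e := by
      rw [mul_comm _ e]
      refine le_trans ?_ hmain
      gcongr
    have h2 := le_of_mul_le_mul_left h1 (by positivity)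
    linarith
  · have h1 : ‖F x‖ ^ p ≤ (2 * e) ^ p := by
      rw [← norm_pow]
      have h2 := norm_le_norm_add_norm_sub' (F x ^ p) (f x ^ p)
      have h3 : ‖F x ^ p - f x ^ p‖ ≤ e ^ p := by
        have h4 := norm_sub_le_norm_sub_add_norm_sub (F x ^ p) (G.eval (x : ℂ)) (f x ^ p)
        rw [norm_sub_rev (G.eval (x : ℂ))] at h4
        linarith [hdisc x (by rw [hxn]; linarith), hfG x hx1]
      have h5 : ‖f x ^ p‖ ≤ e ^ p := by
        rw [norm_pow]
        gcongr
      have h6 : 2 * e ^ p ≤ (2 * e) ^ p := by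
        rw [mul_pow]
        gcongr
        exact le_self_pow₀ one_le_two hp
      linarith
    have h2 : ‖F x‖ ≤ 2 * e := le_of_pow_le_pow_left₀ hp (by positivity) h1
    linarith [norm_sub_le (F x) (f x)]

theorem exists_mul_eq_mul_add_one {p q : ℕ} (hp : p ≠ 0) (hq : q ≠ 0) (hpq : Nat.gcd p q = 1) :
    ∃ a b : ℕ, a ≠ 0 ∧ b ≠ 0 ∧ a * q = b * p + 1 := by
  have h := Nat.gcd_eq_gcd_ab p q
  rw [hpq] at h
  set x := Nat.gcdA p q
  set y := Nat.gcdB p q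
  have hp1 : (1 : ℤ) ≤ p := by exact_mod_cast Nat.one_le_iff_ne_zero.mpr hp
  have hq1 : (1 : ℤ) ≤ q := by exact_mod_cast Nat.one_le_iff_ne_zero.mpr hq
  have hN : 0 ≤ |x| + |y| + 1 := by positivity
  have ha : 0 < y + (|x| + |y| + 1) * p := by
    nlinarith [neg_abs_le y, abs_nonneg x, abs_nonneg y]
  have hb : 0 < -x + (|x| + |y| + 1) * q := by
    nlinarith [le_abs_self x, abs_nonneg x, abs_nonneg y]
  refine ⟨(y + (|x| + |y| + 1) * p).toNat, (-x + (|x| + |y| + 1) * q).toNat, by omega, by omega, ?_⟩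
  zify
  rw [Int.toNat_of_nonneg ha.le, Int.toNat_of_nonneg hb.le]
  push_cast at h
  linear_combination -h

theorem mul_pow_le_mul_pow_of_one_le {K x : ℝ} (hK : 1 ≤ K) (hx : 0 ≤ x) {n : ℕ} (hn : n ≠ 0) :
    K * x ^ n ≤ (K * x) ^ n := by
  rw [mul_pow]
  gcongr
  exact le_self_pow₀ hK hn

/-- If `f ^ p` and `f ^ q`, with `p` and `q` coprime, are exponentially well approximated by
bounded polynomials of degree `n`, then so is `f`, on a smaller interval. -/
theorem exists_polynomial_approx_of_pow {p q : ℕ} (hp : p ≠ 0) (hq : q ≠ 0)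
    (hpq : Nat.gcd p q = 1) {E : ℝ} (hE : 0 < E) (hE1 : E ≤ 1) :
    ∃ D : ℝ, 0 < D ∧ D < 1 ∧ ∀ n : ℕ, n ≠ 0 → ∀ (f : ℝ → ℂ) (G H : Polynomial ℂ),
      G.natDegree ≤ n → H.natDegree ≤ n → (∀ z, ‖z‖ ≤ 2 → ‖G.eval z‖ ≤ 1) →
      (∀ z, ‖z‖ ≤ 2 → ‖H.eval z‖ ≤ 1) →
      (∀ x : ℝ, |x| ≤ 1 → ‖f x ^ p - G.eval (x : ℂ)‖ ≤ D ^ n) →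
      (∀ x : ℝ, |x| ≤ 1 → ‖f x ^ q - H.eval (x : ℂ)‖ ≤ D ^ n) →
      ∃ P : Polynomial ℂ, P.natDegree ≤ n ∧
        ∀ x : ℝ, |x| ≤ E / 16 → ‖P.eval (x : ℂ) - f x‖ ≤ 5 * E ^ n := by
  obtain ⟨a, b, ha, hb, hab⟩ := exists_mul_eq_mul_add_one hp hq hpq
  have hp0 : (1 : ℝ) ≤ p := by exact_mod_cast Nat.one_le_iff_ne_zero.mpr hp
  have ha0 : (1 : ℝ) ≤ a := by exact_mod_cast Nat.one_le_iff_ne_zero.mpr ha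
  obtain ⟨c, hc⟩ : ∃ c : ℝ, c = p * 2 ^ p * 3 + 3 + 2 * b * 2 ^ b + a * 2 ^ a := ⟨_, rfl⟩
  have hc1 : 1 ≤ c := by
    have : 0 ≤ (p : ℝ) * 2 ^ p * 3 + 2 * b * 2 ^ b + a * 2 ^ a := by positivity
    linarith
  obtain ⟨L, hL⟩ : ∃ L : ℝ, L = q * 2 ^ q + p * 2 ^ p := ⟨_, rfl⟩
  have hL1 : 1 ≤ L := by
    have h1 : 0 ≤ (q : ℝ) * 2 ^ q := by positivity
    have h2 : 1 ≤ (p : ℝ) * 2 ^ p := one_le_mul_of_one_le_of_one_le hp0 (one_le_pow₀ one_le_two)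
    linarith
  obtain ⟨S, hS⟩ : ∃ S : ℝ, S = (E ^ p / 512) ^ b := ⟨_, rfl⟩
  have hS0 : 0 < S := by rw [hS]; positivity
  have hEp1 : E ^ p ≤ 1 := pow_le_one₀ hE.le hE1
  have hS1 : S ≤ 1 := by
    rw [hS]
    exact pow_le_one₀ (by positivity) (by linarith)
  obtain ⟨T, hT⟩ : ∃ T : ℝ, T = S ^ (p + 3) * E ^ (b * p + p) / c := ⟨_, rfl⟩
  have hT0 : 0 < T := by rw [hT]; positivity
  have hcT : c * T = S ^ (p + 3) * E ^ (b * p + p) := by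
    rw [hT]
    field_simp
  have hT1 : T ≤ 1 := by
    have h1 : c * T ≤ 1 := by
      rw [hcT]
      exact mul_le_one₀ (pow_le_one₀ hS0.le hS1) (by positivity) (pow_le_one₀ hE.le hE1)
    nlinarith
  obtain ⟨D, hD⟩ : ∃ D : ℝ, D = (T ^ p / 2) ^ (b * p + 1) / (a * L * 3 ^ (p + q)) := ⟨_, rfl⟩
  have hLpos : 0 < L := by linarith
  have hapos : (0 : ℝ) < a := by linarith
  have hTp1 : T ^ p ≤ 1 := pow_le_one₀ hT0.le hT1
  have hD0 : 0 < D := by rw [hD]; positivity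
  have hDeq : a * L * (D * 3 ^ (p + q)) = (T ^ p / 2) ^ (b * p + 1) := by
    rw [hD]
    field_simp
  have haL : 1 ≤ a * L := one_le_mul_of_one_le_of_one_le ha0 hL1
  have h3 : (1 : ℝ) ≤ 3 ^ (p + q) := one_le_pow₀ (by norm_num)
  refine ⟨D, hD0, ?_, ?_⟩
  · have h1 : (T ^ p / 2) ^ (b * p + 1) < 1 :=
      pow_lt_one₀ (by positivity) (by linarith) (Nat.succ_ne_zero _)
    have h2 : D ≤ a * L * (D * 3 ^ (p + q)) := by
      have : D ≤ D * 3 ^ (p + q) := le_mul_of_one_le_right hD0.le h3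
      exact this.trans (le_mul_of_one_le_left (by positivity) haL)
    linarith
  intro n hn f G H hGn hHn hG hH hfG hfH
  have hDn1 : D ^ n ≤ L * D ^ n * 3 ^ (n * (p + q)) := by
    have h4 : (1 : ℝ) ≤ 3 ^ (n * (p + q)) := one_le_pow₀ (by norm_num)
    have h5 : D ^ n ≤ L * D ^ n := le_mul_of_one_le_left (by positivity) hL1
    exact h5.trans (le_mul_of_one_le_right (by positivity) h4)
  have haδ : a * (L * D ^ n * 3 ^ (n * (p + q))) ≤ ((T ^ n) ^ p / 2) ^ (b * p + 1) := by
    have h4 : a * (L * D ^ n * 3 ^ (n * (p + q))) = a * L * (D * 3 ^ (p + q)) ^ n := by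
      rw [mul_pow, ← pow_mul, mul_comm (p + q) n]
      ring
    rw [h4]
    refine (mul_pow_le_mul_pow_of_one_le haL (by positivity) hn).trans ?_
    rw [hDeq, pow_right_comm]
    gcongr
    rw [div_pow, ← pow_mul, ← pow_mul, mul_comm n p]
    gcongr
    exact le_self_pow₀ one_le_two hn
  have hSn : S ^ n ≤ ((E ^ n) ^ p / 2 * (1 / 256) ^ n) ^ b := by
    rw [hS, pow_right_comm]
    gcongr
    have h4 : (E ^ p / 512) ^ n = (E ^ n) ^ p / 2 ^ n * (1 / 256) ^ n := by
      rw [pow_right_comm E n p, ← div_pow, ← mul_pow]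
      congr 1
      ring
    rw [h4]
    gcongr
    exact le_self_pow₀ one_le_two hn
  obtain ⟨F, hF, hF2, hFf⟩ := exists_holomorphic_approx f p q a b n hp ha hb hab G H hGn hG hH
    (D ^ n) (L * D ^ n * 3 ^ (n * (p + q))) (E ^ n) (T ^ n) ((T ^ n) ^ p / 2) _ (by positivity)
    (pow_le_one₀ hE.le hE1) hfG hfH
    (fun z hz => by
      rw [hL]
      have hD1 : D ≤ 1 := by
        have h1 : (T ^ p / 2) ^ (b * p + 1) ≤ 1 := pow_le_one₀ (by positivity) (by linarith)
        have h2 : D ≤ D * 3 ^ (p + q) := le_mul_of_one_le_right hD0.le h3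
        have h4 : D * 3 ^ (p + q) ≤ a * L * (D * 3 ^ (p + q)) :=
          le_mul_of_one_le_left (by positivity) haL
        linarith
      exact norm_eval_pow_sub_eval_pow_le f p q n G H hGn hHn _ (pow_le_one₀ hD0.le hD1)
        (fun w hw => hG w (by linarith)) (fun w hw => hH w (by linarith)) hfG hfH z hz)
    hDn1 (by positivity) (pow_le_one₀ hT0.le hT1) (by ring) haδ rfl (by
      rw [← hc]
      refine (mul_pow_le_mul_pow_of_one_le hc1 hT0.le hn).trans ?_
      rw [hcT, mul_pow, pow_right_comm S, pow_right_comm E]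
      gcongr)
  obtain ⟨P, hP, hPF⟩ := exists_polynomial_norm_sub_le (by norm_num) hE hE1 hF hF2 n
  refine ⟨P, hP, fun x hx => ?_⟩
  have hx8 : |x| ≤ 1 / 8 := by linarith
  have h4 := hPF x (by
    rw [Complex.norm_real, Real.norm_eq_abs]
    linarith)
  have h5 := norm_sub_le_norm_sub_add_norm_sub (P.eval (x : ℂ)) (F x) (f x)
  linarith [hFf x hx8]

theorem norm_sub_taylorWithinEval_le {f : ℝ → ℂ} {Ω : Set ℝ} (hΩ : IsOpen Ω) {x y C : ℝ} {n : ℕ}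
    (hf : ContDiffOn ℝ (n + 1 : ℕ) f Ω) (hxy : Set.uIcc x y ⊆ Ω)
    (hC : ∀ t ∈ Set.uIcc x y, ‖iteratedDerivWithin (n + 1) f Ω t‖ ≤ C) :
    ‖f y - taylorWithinEval f n Ω x y‖ ≤ C * |y - x| ^ (n + 1) / n.factorial := by
  have hC0 : 0 ≤ C := (norm_nonneg _).trans (hC x Set.left_mem_uIcc)
  have hder : ∀ t ∈ Set.uIcc x y, HasDerivWithinAt (fun t => taylorWithinEval f n Ω t y)
      (((n.factorial : ℝ)⁻¹ * (y - t) ^ n) • iteratedDerivWithin (n + 1) f Ω t)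
      (Set.uIcc x y) t := by
    intro t ht
    have htΩ := hxy ht
    refine HasDerivWithinAt.mono ?_ hxy
    refine hasDerivWithinAt_taylorWithinEval hΩ.uniqueDiffOn
      self_mem_nhdsWithin htΩ subset_rfl (hf.of_le (by exact_mod_cast n.le_succ)) ?_
    exact (hf.differentiableOn_iteratedDerivWithin (by exact_mod_cast n.lt_succ_self)
      hΩ.uniqueDiffOn) t htΩ
  have h := (convex_uIcc x y).norm_image_sub_le_of_norm_hasDerivWithin_le
    (C := C * |y - x| ^ n / n.factorial) hder (fun t ht => ?_) Set.left_mem_uIcc Set.right_mem_uIcc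
  · rw [taylorWithinEval_self, Real.norm_eq_abs] at h
    refine h.trans (le_of_eq ?_)
    rw [pow_succ]
    ring
  · have h1 : |y - t| ≤ |y - x| := by
      have := Set.abs_sub_right_of_mem_uIcc ht
      exact this
    rw [norm_smul, norm_mul, norm_inv, norm_pow, Real.norm_eq_abs, Real.norm_eq_abs, Nat.abs_cast,
      inv_mul_eq_div, div_mul_eq_mul_div, mul_comm C]
    gcongr
    exact hC t ht

theorem exists_polynomial_approx_of_bound {f : ℝ → ℂ} {Ω K : Set ℝ} (hΩ : IsOpen Ω)
    (hf : ContDiffOn ℝ (⊤ : ℕ∞) f Ω) (hK : K ⊆ Ω) {M : ℕ → ℝ} (hM : ∀ j, 0 ≤ M j)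
    {σ C B ε x : ℝ} {n : ℕ} (hn : n ≠ 0)
    (hσ : 0 < σ) (hC : 0 ≤ C)
    (hbd : ∀ j : ℕ, ∀ x ∈ K, ‖iteratedDerivWithin j f Ω x‖ ≤ C * σ ^ j * (j.factorial : ℝ) * M j)
    (hB : 4 * σ ≤ B) (hε : 0 < ε) (hMε : ∀ j ≤ n, M j * ε ^ j ≤ (1 / B) ^ j)
    (hx : Metric.closedBall x ε ⊆ K) :
    ∃ P : Polynomial ℂ, P.natDegree ≤ n ∧ (∀ z, ‖z‖ ≤ 2 → ‖P.eval z‖ ≤ 2 * C) ∧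
      ∀ t : ℝ, |t| ≤ 1 → ‖f (x + ε * t) - P.eval (t : ℂ)‖ ≤ C * (2 * σ / B) ^ n := by
  obtain ⟨m, rfl⟩ := Nat.exists_eq_succ_of_ne_zero hn
  have hB0 : 0 < B := by linarith
  have hxK : x ∈ K := hx (Metric.mem_closedBall_self hε.le)
  let c : ℕ → ℂ := fun k => (((k.factorial : ℝ)⁻¹ * ε ^ k : ℝ) : ℂ) * iteratedDerivWithin k f Ω x
  have hfac : ∀ k : ℕ, (0 : ℝ) < k.factorial := fun k => by exact_mod_cast k.factorial_pos
  have hc : ∀ k ≤ m, ‖c k‖ ≤ C * (σ / B) ^ k := by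
    intro k hk
    have hk' : k ≤ m + 1 := hk.trans m.le_succ
    have h1 := hbd k x hxK
    have h2 := hMε k hk'
    rw [norm_mul, Complex.norm_real, Real.norm_eq_abs,
      abs_of_nonneg (by have := hfac k; positivity)]
    calc (k.factorial : ℝ)⁻¹ * ε ^ k * ‖iteratedDerivWithin k f Ω x‖
        ≤ (k.factorial : ℝ)⁻¹ * ε ^ k * (C * σ ^ k * (k.factorial : ℝ) * M k) := by
          have := hfac k
          gcongr
      _ = C * σ ^ k * (M k * ε ^ k) := by
          have := (hfac k).ne'
          field_simp
      _ ≤ C * σ ^ k * (1 / B) ^ k := by gcongr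
      _ = C * (σ / B) ^ k := by rw [mul_assoc, ← mul_pow, mul_one_div]
  refine ⟨∑ k ∈ Finset.range (m + 1), Polynomial.monomial k (c k), ?_, fun z hz => ?_,
    fun t ht => ?_⟩
  · refine Polynomial.natDegree_sum_le_of_forall_le _ _ fun k hk => ?_
    exact (Polynomial.natDegree_monomial_le _).trans (Finset.mem_range.mp hk).le
  · rw [Polynomial.eval_finsetSum]
    simp only [Polynomial.eval_monomial]
    have h1 : ∀ k ∈ Finset.range (m + 1), ‖c k * z ^ k‖ ≤ C * (1 / 2) ^ k := by
      intro k hk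
      rw [norm_mul, norm_pow]
      calc ‖c k‖ * ‖z‖ ^ k ≤ C * (σ / B) ^ k * 2 ^ k := by
            gcongr
            exact hc k (Nat.lt_succ_iff.mp (Finset.mem_range.mp hk))
        _ = C * (σ / B * 2) ^ k := by rw [mul_assoc, ← mul_pow]
        _ ≤ C * (1 / 2) ^ k := by
            gcongr
            rw [div_mul_eq_mul_div, div_le_iff₀ hB0]
            linarith
    refine (norm_sum_le_of_le _ h1).trans ?_
    rw [← Finset.mul_sum, mul_comm 2]
    gcongr
    exact (hasSum_geometric_two.summable.sum_le_tsum _ fun _ _ => by positivity).trans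
      tsum_geometric_two.le
  · have hsub : Set.uIcc x (x + ε * t) ⊆ K := by
      refine subset_trans ?_ hx
      refine (convex_closedBall x ε).ordConnected.uIcc_subset (Metric.mem_closedBall_self hε.le) ?_
      rw [Metric.mem_closedBall, Real.dist_eq, add_sub_cancel_left, abs_mul, abs_of_pos hε]
      exact mul_le_of_le_one_right hε.le ht
    have h1 := norm_sub_taylorWithinEval_le (n := m) hΩ (hf.of_le (by exact_mod_cast le_top))
      (hsub.trans hK) (fun s hs => hbd (m + 1) s (hsub hs))
    have h2 : (∑ k ∈ Finset.range (m + 1), Polynomial.monomial k (c k)).eval (t : ℂ) =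
        taylorWithinEval f m Ω x (x + ε * t) := by
      rw [Polynomial.eval_finsetSum, taylor_within_apply]
      refine Finset.sum_congr rfl fun k _ => ?_
      rw [Polynomial.eval_monomial, Complex.real_smul]
      simp only [c]
      push_cast
      ring
    rw [h2]
    refine h1.trans ?_
    have h3 : |x + ε * t - x| ≤ ε := by
      rw [add_sub_cancel_left, abs_mul, abs_of_pos hε]
      exact mul_le_of_le_one_right hε.le ht
    have hM' := hM (m + 1)
    have h4 : ((m + 1 : ℕ) : ℝ) ≤ 2 ^ (m + 1) := by exact_mod_cast Nat.lt_two_pow_self.le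
    calc C * σ ^ (m + 1) * ((m + 1).factorial : ℝ) * M (m + 1) * |x + ε * t - x| ^ (m + 1) /
          m.factorial
        ≤ C * σ ^ (m + 1) * ((m + 1).factorial : ℝ) * M (m + 1) * ε ^ (m + 1) / m.factorial := by
          have := hfac m
          gcongr
      _ = C * σ ^ (m + 1) * (m + 1 : ℕ) * (M (m + 1) * ε ^ (m + 1)) := by
          rw [Nat.factorial_succ]
          have := (hfac m).ne'
          push_cast
          field_simp
      _ ≤ C * σ ^ (m + 1) * 2 ^ (m + 1) * (1 / B) ^ (m + 1) := by
          gcongr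
          · exact hMε _ le_rfl
      _ = C * (2 * σ / B) ^ (m + 1) := by
          rw [mul_assoc, mul_assoc, ← mul_pow, ← mul_pow]
          congr 2
          ring

namespace IsWeightSeq

variable {M : ℕ → ℝ}

theorem monotone_ratio (hM : IsWeightSeq M) : Monotone fun n => M (n + 1) / M n :=
  monotone_nat_of_le_succ hM.2.2.2.1

theorem one_le_ratio (hM : IsWeightSeq M) (n : ℕ) : 1 ≤ M (n + 1) / M n :=
  (one_le_div (hM.1 n)).mpr (hM.2.1 n.le_succ)

theorem le_ratio_pow (hM : IsWeightSeq M) {j n : ℕ} (h : j ≤ n) :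
    M j ≤ (M (n + 1) / M n) ^ j := by
  induction j with
  | zero => simp [hM.2.2.1]
  | succ j ih =>
    have h1 := hM.monotone_ratio (show j ≤ n by omega)
    have h2 := ih (by omega)
    have h3 := (zero_le_one.trans (hM.one_le_ratio n))
    calc M (j + 1) = M j * (M (j + 1) / M j) := by
          have := (hM.1 j).ne'
          field_simp
      _ ≤ (M (n + 1) / M n) ^ j * (M (n + 1) / M n) :=
          mul_le_mul h2 h1 (zero_le_one.trans (hM.one_le_ratio j)) (by positivity)
      _ = _ := (pow_succ _ _).symm

theorem ratio_pow_mul_le (hM : IsWeightSeq M) (j n : ℕ) :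
    (M (n + 1) / M n) ^ j * M n ≤ M (n + j) := by
  induction j with
  | zero => simp
  | succ j ih =>
    have h1 := hM.monotone_ratio (show n ≤ n + j by omega)
    have h3 := (zero_le_one.trans (hM.one_le_ratio n))
    calc (M (n + 1) / M n) ^ (j + 1) * M n
        = ((M (n + 1) / M n) ^ j * M n) * (M (n + 1) / M n) := by ring
      _ ≤ M (n + j) * (M (n + j + 1) / M (n + j)) := mul_le_mul ih h1 h3 (hM.1 _).le
      _ = M (n + (j + 1)) := by
          have := (hM.1 (n + j)).ne'
          rw [← add_assoc]
          field_simp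

theorem tendsto_ratio (hM : IsWeightSeq M) :
    Tendsto (fun n => M (n + 1) / M n) atTop atTop := by
  refine tendsto_atTop_atTop_of_monotone hM.monotone_ratio fun b => ?_
  by_contra! hb
  obtain ⟨j, hj, hj0⟩ := ((hM.2.2.2.2.eventually_gt_atTop b).and (eventually_ne_atTop 0)).exists
  have h1 := hM.le_ratio_pow (le_refl j)
  have h2 : M j ≤ b ^ j :=
    h1.trans (pow_le_pow_left₀ (zero_le_one.trans (hM.one_le_ratio j)) (hb j).le j)
  have hb0 : 0 ≤ b := zero_le_one.trans ((hM.one_le_ratio 0).trans (hb 0).le)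
  have h3 : M j ^ (1 / (j : ℝ)) ≤ (b ^ j) ^ (1 / (j : ℝ)) :=
    Real.rpow_le_rpow (hM.1 j).le h2 (by positivity)
  rw [one_div (j : ℝ), Real.pow_rpow_inv_natCast hb0 hj0] at h3
  rw [one_div] at hj
  exact absurd h3 (not_le.mpr hj)

end IsWeightSeq

theorem exists_local_polynomial_approx {M : ℕ → ℝ} (hM : IsWeightSeq M) {Ω : Set ℝ}
    (hΩ : IsOpen Ω) {f : ℝ → ℂ} {p q : ℕ} (hp : p ≠ 0) (hq : q ≠ 0) (hpq : Nat.gcd p q = 1)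
    (hfp : IsCMOn M (fun x => f x ^ p) Ω) (hfq : IsCMOn M (fun x => f x ^ q) Ω)
    {X : Set ℝ} (hX : IsCompact X) (hXΩ : X ⊆ Ω) {E : ℝ} (hE : 0 < E) (hE1 : E ≤ 1) :
    ∃ U : Set ℝ, IsOpen U ∧ X ⊆ U ∧ U ⊆ Ω ∧ ∃ B > 0, ∃ C ≥ 0, ∀ n : ℕ, n ≠ 0 → ∀ x ∈ U,
      ∃ P : Polynomial ℂ, P.natDegree ≤ n ∧
        ∀ y : ℝ, |y - x| ≤ 1 / (B * (M (n + 1) / M n)) →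
          ‖f y‖ ≤ C ∧ ‖P.eval (y : ℂ) - f y‖ ≤ C * E ^ n := by
  obtain ⟨D, hD, hD1, key⟩ := exists_polynomial_approx_of_pow hp hq hpq hE hE1
  obtain ⟨δ, hδ, hδΩ⟩ := hX.exists_cthickening_subset_open hΩ hXΩ
  have hK : IsCompact (Metric.cthickening δ X) := hX.cthickening
  obtain ⟨σ₁, hσ₁, C₁, hC₁, hb₁⟩ := hfp.2 _ hδΩ hK
  obtain ⟨σ₂, hσ₂, C₂, hC₂, hb₂⟩ := hfq.2 _ hδΩ hK
  have hM0 : ∀ j, 0 ≤ M j := fun j => (hM.1 j).le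
  set σ := σ₁ + σ₂ with hσ
  set C := C₁ + C₂ with hC
  have hσ0 : 0 < σ := by positivity
  have hC0 : 0 ≤ C := by positivity
  have hb₁' : ∀ j : ℕ, ∀ x ∈ Metric.cthickening δ X,
      ‖iteratedDerivWithin j (fun x => f x ^ p) Ω x‖ ≤ C * σ ^ j * (j.factorial : ℝ) * M j := by
    intro j x hx
    refine (hb₁ j x hx).trans ?_
    have := hM0 j
    gcongr <;> linarith
  have hb₂' : ∀ j : ℕ, ∀ x ∈ Metric.cthickening δ X,
      ‖iteratedDerivWithin j (fun x => f x ^ q) Ω x‖ ≤ C * σ ^ j * (j.factorial : ℝ) * M j := by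
    intro j x hx
    refine (hb₂ j x hx).trans ?_
    have := hM0 j
    gcongr <;> linarith
  set B := 4 * σ + 2 * σ / D + 1 / (δ / 2) with hB
  have hB0 : 0 < B := by positivity
  have hB1 : 4 * σ ≤ B := by
    have : 0 < 2 * σ / D + 1 / (δ / 2) := by positivity
    linarith
  have hB2 : 2 * σ / B ≤ D := by
    rw [div_le_iff₀ hB0, ← div_le_iff₀' hD]
    have : 0 < 4 * σ + 1 / (δ / 2) := by positivity
    linarith
  have hB3 : 1 / B ≤ δ / 2 := by
    rw [one_div_le hB0 (by positivity)]
    have : 0 < 4 * σ + 2 * σ / D := by positivity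
    linarith
  set Λ := 2 * C + 1 with hΛ
  have hΛ1 : 1 ≤ Λ := by linarith
  have hΛ0 : 0 < Λ := by linarith
  have hΛC : ∀ r : ℕ, r ≠ 0 → 2 * C ≤ Λ ^ r := fun r hr =>
    le_trans (by linarith) (le_self_pow₀ hΛ1 hr)
  refine ⟨Metric.thickening (δ / 2) X, Metric.isOpen_thickening,
    Metric.self_subset_thickening (by positivity) X,
    ((Metric.thickening_mono (by linarith) X).trans (Metric.thickening_subset_cthickening δ X)).trans
      hδΩ, 16 * B / E, by positivity, 5 * Λ, by positivity, fun n hn x hx => ?_⟩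
  have hν := hM.one_le_ratio n
  set ν := M (n + 1) / M n with hνdef
  have hν0 : 0 < ν := by linarith
  set ε := 1 / (B * ν) with hε
  have hε0 : 0 < ε := by positivity
  have hεB : ε ≤ 1 / B := one_div_le_one_div_of_le hB0 (le_mul_of_one_le_right hB0.le hν)
  have hMε : ∀ j ≤ n, M j * ε ^ j ≤ (1 / B) ^ j := by
    intro j hj
    calc M j * ε ^ j ≤ ν ^ j * ε ^ j := by
          gcongr
          exact hM.le_ratio_pow hj
      _ = (1 / B) ^ j := by
          rw [← mul_pow]
          congr 1
          rw [hε]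
          field_simp
  have hball : Metric.closedBall x ε ⊆ Metric.cthickening δ X := by
    intro y hy
    rw [Metric.mem_thickening_iff] at hx
    obtain ⟨z, hz, hxz⟩ := hx
    refine Metric.mem_cthickening_of_dist_le y z δ X hz ?_
    have := dist_triangle y x z
    rw [Metric.mem_closedBall] at hy
    linarith
  obtain ⟨G, hGd, hG2, hGf⟩ :=
    exists_polynomial_approx_of_bound hΩ hfp.1 hδΩ hM0 hn hσ0 hC0 hb₁' hB1 hε0 hMε hball
  obtain ⟨H, hHd, hH2, hHf⟩ :=
    exists_polynomial_approx_of_bound hΩ hfq.1 hδΩ hM0 hn hσ0 hC0 hb₂' hB1 hε0 hMε hball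
  have hdeg : ∀ (r : ℕ) (Q : Polynomial ℂ), Q.natDegree ≤ n →
      (Polynomial.C (((Λ ^ r)⁻¹ : ℝ) : ℂ) * Q).natDegree ≤ n := fun r Q hQ =>
    (Polynomial.natDegree_C_mul_le _ _).trans hQ
  have hnorm : ∀ r : ℕ, ‖(((Λ ^ r)⁻¹ : ℝ) : ℂ)‖ = (Λ ^ r)⁻¹ := fun r => by
    rw [Complex.norm_real, Real.norm_eq_abs, abs_of_pos (by positivity)]
  have hbound : ∀ (r : ℕ), r ≠ 0 → ∀ (Q : Polynomial ℂ), (∀ z, ‖z‖ ≤ 2 → ‖Q.eval z‖ ≤ 2 * C) →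
      ∀ z, ‖z‖ ≤ 2 → ‖(Polynomial.C (((Λ ^ r)⁻¹ : ℝ) : ℂ) * Q).eval z‖ ≤ 1 := by
    intro r hr Q hQ z hz
    rw [Polynomial.eval_C_mul, norm_mul, hnorm, inv_mul_le_iff₀ (by positivity), mul_one]
    exact (hQ z hz).trans (hΛC r hr)
  have happrox : ∀ (r : ℕ), r ≠ 0 → ∀ (Q : Polynomial ℂ),
      (∀ t : ℝ, |t| ≤ 1 → ‖f (x + ε * t) ^ r - Q.eval (t : ℂ)‖ ≤ C * (2 * σ / B) ^ n) →
      ∀ t : ℝ, |t| ≤ 1 → ‖(((Λ⁻¹ : ℝ) : ℂ) * f (x + ε * t)) ^ r -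
        (Polynomial.C (((Λ ^ r)⁻¹ : ℝ) : ℂ) * Q).eval (t : ℂ)‖ ≤ D ^ n := by
    intro r hr Q hQ t ht
    have h1 : (((Λ⁻¹ : ℝ) : ℂ) * f (x + ε * t)) ^ r -
        (Polynomial.C (((Λ ^ r)⁻¹ : ℝ) : ℂ) * Q).eval (t : ℂ) =
        (((Λ ^ r)⁻¹ : ℝ) : ℂ) * (f (x + ε * t) ^ r - Q.eval (t : ℂ)) := by
      rw [Polynomial.eval_C_mul, mul_pow, mul_sub]
      push_cast
      rw [inv_pow]
    rw [h1, norm_mul, hnorm, inv_mul_le_iff₀ (by positivity)]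
    refine (hQ t ht).trans ?_
    have := hΛC r hr
    gcongr
    linarith
  obtain ⟨P, hPd, hP⟩ := key n hn (fun t => ((Λ⁻¹ : ℝ) : ℂ) * f (x + ε * t)) _ _
    (hdeg p G hGd) (hdeg q H hHd) (hbound p hp G hG2) (hbound q hq H hH2)
    (happrox p hp G hGf) (happrox q hq H hHf)
  refine ⟨Polynomial.C (Λ : ℂ) * P.comp (Polynomial.C ((ε⁻¹ : ℝ) : ℂ) *
    (Polynomial.X - Polynomial.C (x : ℂ))), ?_, fun y hy => ?_⟩
  · refine (Polynomial.natDegree_C_mul_le _ _).trans (Polynomial.natDegree_comp_le.trans ?_)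
    have h1 : (Polynomial.C ((ε⁻¹ : ℝ) : ℂ) *
        (Polynomial.X - Polynomial.C (x : ℂ))).natDegree ≤ 1 :=
      (Polynomial.natDegree_C_mul_le _ _).trans (Polynomial.natDegree_X_sub_C_le _)
    calc _ ≤ P.natDegree * 1 := Nat.mul_le_mul_left _ h1
      _ ≤ n := by rwa [mul_one]
  · have h1 : |ε⁻¹ * (y - x)| ≤ E / 16 := by
      rw [abs_mul, abs_of_pos (inv_pos.mpr hε0), inv_mul_le_iff₀ hε0]
      refine hy.trans (le_of_eq ?_)
      rw [hε]
      field_simp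
    have h2 := hP _ h1
    have hyK : y ∈ Metric.cthickening δ X := by
      refine hball ?_
      rw [Metric.mem_closedBall, Real.dist_eq]
      refine hy.trans ?_
      rw [hε]
      gcongr
      rw [le_div_iff₀ hE]
      nlinarith
    have hfy : ‖f y‖ ≤ Λ := by
      have h := hb₁' 0 y hyK
      rw [iteratedDerivWithin_zero, norm_pow, hM.2.2.1] at h
      have h' := hΛC p hp
      refine le_of_pow_le_pow_left₀ hp hΛ0.le (h.trans ?_)
      simp only [pow_zero, Nat.factorial_zero, Nat.cast_one, mul_one]
      linarith
    refine ⟨by linarith, ?_⟩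
    have h3 : x + ε * (ε⁻¹ * (y - x)) = y := by
      field_simp
      ring
    simp only [h3] at h2
    have h4 : (Polynomial.C (Λ : ℂ) * P.comp (Polynomial.C ((ε⁻¹ : ℝ) : ℂ) *
        (Polynomial.X - Polynomial.C (x : ℂ)))).eval (y : ℂ) - f y =
        (Λ : ℂ) * (P.eval ((ε⁻¹ * (y - x) : ℝ) : ℂ) - ((Λ⁻¹ : ℝ) : ℂ) * f y) := by
      have : (Λ : ℂ) ≠ 0 := by exact_mod_cast hΛ0.ne'
      simp only [Polynomial.eval_mul, Polynomial.eval_C, Polynomial.eval_comp, Polynomial.eval_sub,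
        Polynomial.eval_X]
      push_cast
      field_simp
    rw [h4, norm_mul, Complex.norm_real, Real.norm_eq_abs, abs_of_pos hΛ0]
    calc Λ * _ ≤ Λ * (5 * E ^ n) := by gcongr
      _ = _ := by ring

theorem hasDerivAt_eval_iterate_derivative (R : Polynomial ℂ) (j : ℕ) (y : ℂ) :
    HasDerivAt (fun z => (Polynomial.derivative^[j] R).eval z)
      ((Polynomial.derivative^[j + 1] R).eval y) y := by
  rw [Function.iterate_succ_apply']
  exact (Polynomial.derivative^[j] R).hasDerivAt y

theorem iteratedDeriv_polynomial_eval (R : Polynomial ℂ) (j : ℕ) :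
    iteratedDeriv j (fun z => R.eval z) = fun z => (Polynomial.derivative^[j] R).eval z := by
  induction j with
  | zero => simp
  | succ j ih =>
    rw [iteratedDeriv_succ, ih]
    exact funext fun z => (hasDerivAt_eval_iterate_derivative R j z).deriv

theorem norm_eval_iterate_derivative_le (R : Polynomial ℂ) {m : ℕ} (hd : R.natDegree ≤ m)
    {x ε δ : ℝ} (hε : 0 < ε) (hR : ∀ y : ℝ, |y - x| ≤ ε → ‖R.eval (y : ℂ)‖ ≤ δ) (j : ℕ) {y : ℝ}
    (hy : |y - x| ≤ ε) :
    ‖(Polynomial.derivative^[j] R).eval (y : ℂ)‖ ≤ j.factorial * (δ * 5 ^ m * (1 / ε) ^ j) := by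
  have hδ : 0 ≤ δ := (norm_nonneg _).trans (hR x (by simpa using hε.le))
  have hε' : (ε : ℂ) ≠ 0 := by exact_mod_cast hε.ne'
  set S := R.comp (Polynomial.C (ε : ℂ) * Polynomial.X + Polynomial.C (x : ℂ)) with hS
  have hSd : S.natDegree ≤ m := by
    refine Polynomial.natDegree_comp_le.trans ?_
    calc _ ≤ R.natDegree * 1 := Nat.mul_le_mul_left _ Polynomial.natDegree_linear_le
      _ ≤ m := by rwa [mul_one]
  have hSe : ∀ z, S.eval z = R.eval ((ε : ℂ) * z + x) := fun z => by simp [hS]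
  have hS1 : ∀ t : ℝ, |t| ≤ 1 → ‖S.eval (t : ℂ)‖ ≤ δ := by
    intro t ht
    have := hR (ε * t + x) (by
      rw [add_sub_cancel_right, abs_mul, abs_of_pos hε]
      exact mul_le_of_le_one_right hε.le ht)
    rw [hSe]
    exact_mod_cast this
  have hR2 : ∀ w ∈ Metric.sphere (y : ℂ) ε, ‖R.eval w‖ ≤ δ * 5 ^ m := by
    intro w hw
    rw [mem_sphere_iff_norm] at hw
    have h1 := norm_eval_le_of_norm_le_on_unit_interval S m hSd δ hS1 ((w - x) / ε)
    rw [hSe, mul_div_cancel₀ _ hε', sub_add_cancel] at h1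
    refine h1.trans ?_
    have h2 : ‖(w - x) / (ε : ℂ)‖ ≤ 2 := by
      rw [norm_div, Complex.norm_real, Real.norm_eq_abs, abs_of_pos hε, div_le_iff₀ hε]
      have h3 : w - x = (w - y) + ((y - x : ℝ) : ℂ) := by push_cast; ring
      rw [h3]
      refine (norm_add_le _ _).trans ?_
      rw [hw, Complex.norm_real, Real.norm_eq_abs]
      linarith
    gcongr
    linarith
  have h := Complex.norm_iteratedDeriv_le_of_forall_mem_sphere_norm_le (f := fun z => R.eval z) j hε
    R.differentiable.diffContOnCl hR2
  rw [iteratedDeriv_polynomial_eval] at h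
  refine h.trans (le_of_eq ?_)
  rw [one_div, inv_pow]
  ring

theorem norm_eval_sub_sub_le (R : Polynomial ℂ) (j : ℕ) {x y K : ℝ}
    (hK : ∀ t : ℝ, |t - x| ≤ |y - x| → ‖(Polynomial.derivative^[j + 2] R).eval (t : ℂ)‖ ≤ K) :
    ‖(Polynomial.derivative^[j] R).eval (y : ℂ) - (Polynomial.derivative^[j] R).eval (x : ℂ) -
      (Polynomial.derivative^[j + 1] R).eval (x : ℂ) * (y - x)‖ ≤ K * |y - x| ^ 2 := by
  have hK0 : 0 ≤ K := (norm_nonneg _).trans (hK x (by simp))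
  have hmem : ∀ t ∈ Set.uIcc x y, |t - x| ≤ |y - x| := fun t ht =>
    Set.abs_sub_left_of_mem_uIcc ht
  have hder : ∀ (i : ℕ) (t : ℝ),
      HasDerivAt (fun t : ℝ => (Polynomial.derivative^[i] R).eval (t : ℂ))
      ((Polynomial.derivative^[i + 1] R).eval (t : ℂ)) t := fun i t =>
    (hasDerivAt_eval_iterate_derivative R i t).comp_ofReal
  have h1 : ∀ t ∈ Set.uIcc x y, ‖(Polynomial.derivative^[j + 1] R).eval (t : ℂ) -
      (Polynomial.derivative^[j + 1] R).eval (x : ℂ)‖ ≤ K * |y - x| := by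
    intro t ht
    refine ((convex_uIcc x y).norm_image_sub_le_of_norm_hasDerivWithin_le
      (fun s _ => (hder (j + 1) s).hasDerivWithinAt) (fun s hs => hK s (hmem s hs))
      Set.left_mem_uIcc ht).trans ?_
    rw [Real.norm_eq_abs]
    exact mul_le_mul_of_nonneg_left (hmem t ht) hK0
  have h2 := (convex_uIcc x y).norm_image_sub_le_of_norm_hasDerivWithin_le
    (f := fun t : ℝ => (Polynomial.derivative^[j] R).eval (t : ℂ) -
      (Polynomial.derivative^[j + 1] R).eval (x : ℂ) * (t : ℂ))
    (fun s _ => ((hder j s).sub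
      (((hasDerivAt_id (s : ℂ)).comp_ofReal).const_mul _)).hasDerivWithinAt)
    (fun s hs => by simpa using h1 s hs) Set.left_mem_uIcc Set.right_mem_uIcc
  rw [Real.norm_eq_abs, mul_assoc, ← sq] at h2
  refine le_trans (le_of_eq ?_) h2
  congr 1
  ring

/-- A function which near every point of an open set is rapidly approximated by polynomials of
degree `2 ^ k`, on intervals of radius `ε k`, is smooth there, with the corresponding derivative
bounds. -/
theorem exists_derivatives_of_polynomial_approx {U : Set ℝ} (hU : IsOpen U) {f : ℝ → ℂ}
    {P : ℝ → ℕ → Polynomial ℂ} {ε η L : ℕ → ℝ} (hε0 : ∀ k, 0 < ε k) (hε : Antitone ε)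
    (hεlim : Tendsto ε atTop (𝓝 0)) (hη0 : ∀ k, 0 ≤ η k) (hη : Antitone η)
    (hL : ∀ j k : ℕ, 2 * η k * 25 ^ 2 ^ k * (1 / ε (k + 1)) ^ j ≤ L j * (1 / 2) ^ k)
    (hP0 : ∀ x, P x 0 = 0) (hPd : ∀ x ∈ U, ∀ k, (P x k).natDegree ≤ 2 ^ k)
    (hP : ∀ x ∈ U, ∀ (k : ℕ) (y : ℝ), |y - x| ≤ ε k → ‖(P x k).eval (y : ℂ) - f y‖ ≤ η k) :
    ∃ a : ℕ → ℝ → ℂ, (∀ x ∈ U, a 0 x = f x) ∧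
      (∀ j, ∀ x ∈ U, HasDerivAt (a j) (a (j + 1) x) x) ∧
      ∀ j, ∀ x ∈ U, ‖a j x‖ ≤ 2 * (j.factorial * L j) := by
  have hL0 : ∀ j, 0 ≤ L j := by
    intro j
    have h1 := hL j 0
    have h2 := hε0 1
    have h3 := hη0 0
    have h4 : 0 ≤ 2 * η 0 * 25 ^ 2 ^ 0 * (1 / ε (0 + 1)) ^ j := by positivity
    simpa using h4.trans h1
  have hhalf : ∀ k : ℕ, ((1 : ℝ) / 2) ^ k ≤ 1 := fun k => pow_le_one₀ (by norm_num) (by norm_num)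
  have hLs : ∀ j s k : ℕ, 2 * η k * 25 ^ 2 ^ k * (1 / ε (k + 1)) ^ j ≤
      L (j + s) * ε (k + 1) ^ s * (1 / 2) ^ k := by
    intro j s k
    have h2 := hε0 (k + 1)
    calc 2 * η k * 25 ^ 2 ^ k * (1 / ε (k + 1)) ^ j
        = 2 * η k * 25 ^ 2 ^ k * (1 / ε (k + 1)) ^ (j + s) * ε (k + 1) ^ s := by
          rw [pow_add, one_div, inv_pow (ε (k + 1)) s]
          field_simp
      _ ≤ L (j + s) * (1 / 2) ^ k * ε (k + 1) ^ s :=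
          mul_le_mul_of_nonneg_right (hL (j + s) k) (by positivity)
      _ = _ := by ring
  have hstep : ∀ x ∈ U, ∀ (s k j : ℕ) (y : ℝ), |y - x| ≤ ε (k + 1) →
      ‖(Polynomial.derivative^[j] (P x (k + 1))).eval (y : ℂ) -
        (Polynomial.derivative^[j] (P x k)).eval (y : ℂ)‖ ≤
        j.factorial * (L (j + s) * ε (k + 1) ^ s * (1 / 2) ^ k) := by
    intro x hx s k j y hy
    have hdeg : (P x (k + 1) - P x k).natDegree ≤ 2 ^ (k + 1) :=
      (Polynomial.natDegree_sub_le _ _).trans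
        (max_le (hPd x hx _) ((hPd x hx k).trans (Nat.pow_le_pow_right two_pos k.le_succ)))
    have h := norm_eval_iterate_derivative_le (P x (k + 1) - P x k) hdeg (δ := 2 * η k)
      (hε0 (k + 1)) (fun t ht => ?_) j hy
    · rw [Polynomial.iterate_derivative_sub, Polynomial.eval_sub] at h
      refine h.trans ?_
      have h5 : (5 : ℝ) ^ 2 ^ (k + 1) = 25 ^ 2 ^ k := by
        rw [pow_succ 2, mul_comm, pow_mul]
        norm_num
      rw [h5]
      exact mul_le_mul_of_nonneg_left (hLs j s k) (by positivity)
    · have h1 := hP x hx (k + 1) t ht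
      have h2 := hP x hx k t (ht.trans (hε k.le_succ))
      have h3 := hη k.le_succ
      rw [Polynomial.eval_sub, ← sub_sub_sub_cancel_right _ _ (f t)]
      exact (norm_sub_le _ _).trans (by linarith)
  have hbound : ∀ x ∈ U, ∀ (k j : ℕ) (y : ℝ), |y - x| ≤ ε k →
      ‖(Polynomial.derivative^[j] (P x k)).eval (y : ℂ)‖ ≤
        j.factorial * L j * (2 * (1 - (1 / 2) ^ k)) := by
    intro x hx k j
    induction k with
    | zero => intro y _; simp [hP0]
    | succ k ih =>
      intro y hy
      have h1 := hstep x hx 0 k j y hy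
      have h2 := ih y (hy.trans (hε k.le_succ))
      have h3 := norm_le_norm_add_norm_sub' ((Polynomial.derivative^[j] (P x (k + 1))).eval (y : ℂ))
        ((Polynomial.derivative^[j] (P x k)).eval (y : ℂ))
      refine h3.trans ((add_le_add h2 h1).trans (le_of_eq ?_))
      rw [add_zero, pow_zero, mul_one, pow_succ]
      ring
  have hgeom : ∀ x ∈ U, ∀ s k j i : ℕ,
      dist ((Polynomial.derivative^[j] (P x (k + i))).eval (x : ℂ))
        ((Polynomial.derivative^[j] (P x (k + (i + 1)))).eval (x : ℂ)) ≤
        j.factorial * (L (j + s) * ε (k + 1) ^ s) * (1 / 2) ^ i := by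
    intro x hx s k j i
    rw [dist_comm, dist_eq_norm]
    refine (hstep x hx s (k + i) j x (by simpa using (hε0 _).le)).trans ?_
    rw [← mul_assoc]
    have h1 := hL0 (j + s)
    have h2 := (hε0 (k + i + 1)).le
    have h3 : ε (k + i + 1) ≤ ε (k + 1) := hε (by omega)
    have h4 : ((1 : ℝ) / 2) ^ (k + i) ≤ (1 / 2) ^ i :=
      pow_le_pow_of_le_one (by norm_num) (by norm_num) (by omega)
    have h5 := (hε0 (k + 1)).le
    have h6 : 0 ≤ (j.factorial : ℝ) * (L (j + s) * ε (k + 1) ^ s) := by positivity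
    gcongr
  have hlim : ∀ (j : ℕ) (x : ℝ), ∃ l : ℂ, x ∈ U →
      Tendsto (fun k => (Polynomial.derivative^[j] (P x k)).eval (x : ℂ)) atTop (𝓝 l) := by
    intro j x
    by_cases hx : x ∈ U
    · have hc : CauchySeq fun k => (Polynomial.derivative^[j] (P x k)).eval (x : ℂ) := by
        refine cauchySeq_of_le_geometric (1 / 2)
          (j.factorial * (L (j + 0) * ε (0 + 1) ^ 0)) (by norm_num) fun i => ?_
        simpa only [zero_add] using hgeom x hx 0 0 j i
      obtain ⟨l, hl⟩ := cauchySeq_tendsto_of_complete hc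
      exact ⟨l, fun _ => hl⟩
    · exact ⟨0, fun h => absurd h hx⟩
  choose a ha using hlim
  have htail : ∀ x ∈ U, ∀ s k j : ℕ,
      ‖(Polynomial.derivative^[j] (P x k)).eval (x : ℂ) - a j x‖ ≤
        2 * (j.factorial * (L (j + s) * ε (k + 1) ^ s)) := by
    intro x hx s k j
    have h1 : Tendsto (fun i => (Polynomial.derivative^[j] (P x (k + i))).eval (x : ℂ)) atTop
        (𝓝 (a j x)) := by
      have := (ha j x hx).comp (tendsto_add_atTop_nat k)
      simpa only [Function.comp_def, add_comm] using this
    have h2 := dist_le_of_le_geometric_of_tendsto₀ (1 / 2) _ (by norm_num) (hgeom x hx s k j) h1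
    rw [dist_eq_norm, add_zero] at h2
    exact h2.trans (le_of_eq (by ring))
  refine ⟨a, fun x hx => ?_, fun j x hx => ?_, fun j x hx => ?_⟩
  · refine tendsto_nhds_unique (ha 0 x hx) ?_
    rw [tendsto_iff_norm_sub_tendsto_zero]
    have h1 : Tendsto (fun k : ℕ => L 0 * (1 / 2 : ℝ) ^ k) atTop (𝓝 0) := by
      simpa using (tendsto_pow_atTop_nhds_zero_of_lt_one (r := (1 / 2 : ℝ)) (by norm_num)
        (by norm_num)).const_mul (L 0)
    refine squeeze_zero (fun _ => norm_nonneg _) (fun k => ?_) h1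
    refine (hP x hx k x (by simpa using (hε0 k).le)).trans ?_
    have h2 := hL 0 k
    rw [pow_zero, mul_one] at h2
    refine le_trans ?_ h2
    have h3 : (1 : ℝ) ≤ 25 ^ 2 ^ k := one_le_pow₀ (by norm_num)
    nlinarith [hη0 k]
  · rw [hasDerivAt_iff_isLittleO]
    refine Asymptotics.IsBigO.trans_isLittleO ?_ (Asymptotics.isLittleO_pow_sub_sub x one_lt_two)
    set c : ℝ := 4 * (2 * (j.factorial * L (j + 2)) + 2 * (j.factorial * L (j + 2)) +
      j.factorial * (2 ^ j * L (j + 2))) + 2 * (2 * ((j + 1).factorial * L (j + 2))) +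
      (j + 2).factorial * L (j + 2) * 2 with hc
    refine Asymptotics.IsBigO.of_bound c ?_
    have hnear : ∀ᶠ x' in 𝓝 x, |x' - x| < ε 0 / 2 := by
      have := Metric.ball_mem_nhds x (half_pos (hε0 0))
      filter_upwards [this] with x' hx'
      rwa [Metric.mem_ball, Real.dist_eq] at hx'
    filter_upwards [hnear, hU.mem_nhds hx] with x' hd hx'
    set d := |x' - x| with hd'
    have hd_nonneg : 0 ≤ d := abs_nonneg _
    rcases hd_nonneg.eq_or_lt with h0 | hd0
    · have : x' = x := by
        rw [← sub_eq_zero, ← abs_eq_zero]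
        exact h0.symm
      simp [this]
    · have hex : ∃ k, ε (k + 1) / 2 < d := by
        have h1 : Tendsto (fun k => ε (k + 1)) atTop (𝓝 0) :=
          hεlim.comp (tendsto_add_atTop_nat 1)
        obtain ⟨k, hk⟩ := (h1.eventually_lt_const (show (0 : ℝ) < 2 * d by linarith)).exists
        exact ⟨k, by linarith⟩
      obtain ⟨k, hk1, hk2⟩ : ∃ k, ε (k + 1) / 2 < d ∧ d ≤ ε k / 2 := by
        classical
        refine ⟨Nat.find hex, Nat.find_spec hex, ?_⟩
        rcases Nat.eq_zero_or_eq_succ_pred (Nat.find hex) with h | h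
        · rw [h]
          exact hd.le
        · rw [h]
          exact not_lt.mp (Nat.find_min hex (m := (Nat.find hex).pred) (by omega))
      have hεd : ε (k + 1) ≤ 2 * d := by linarith
      have hεk := hε0 (k + 1)
      have hεsq : ε (k + 1) ^ 2 ≤ 4 * d ^ 2 := by nlinarith
      have hL2 := hL0 (j + 2)
      have e1 := htail x hx 2 k j
      have e2 := htail x' hx' 2 k j
      have e3 := htail x hx 1 k (j + 1)
      have e4 := norm_eval_sub_sub_le (P x k) j (x := x) (y := x')
        (K := (j + 2).factorial * L (j + 2) * 2) (fun t ht => by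
          refine (hbound x hx k (j + 2) t ?_).trans ?_
          · refine ht.trans ?_
            have := hε0 k
            linarith
          · have h1 : (2 : ℝ) * (1 - (1 / 2) ^ k) ≤ 2 := by
              have : (0 : ℝ) ≤ (1 / 2) ^ k := by positivity
              linarith
            exact mul_le_mul_of_nonneg_left h1 (by positivity))
      have e5 : ‖(Polynomial.derivative^[j] (P x' k)).eval (x' : ℂ) -
          (Polynomial.derivative^[j] (P x k)).eval (x' : ℂ)‖ ≤
          j.factorial * (2 ^ j * L (j + 2)) * ε (k + 1) ^ 2 := by
        have h := norm_eval_iterate_derivative_le (P x' k - P x k) (m := 2 ^ k)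
          ((Polynomial.natDegree_sub_le _ _).trans (max_le (hPd x' hx' k) (hPd x hx k)))
          (x := x') (y := x') (δ := 2 * η k) (half_pos (hε0 k)) (fun t ht => ?_) j
          (by simpa using (half_pos (hε0 k)).le)
        · rw [Polynomial.iterate_derivative_sub, Polynomial.eval_sub] at h
          refine h.trans ?_
          rw [mul_assoc (j.factorial : ℝ)]
          refine mul_le_mul_of_nonneg_left ?_ (by positivity)
          have h1 := hLs j 2 k
          have h2 := hη0 k
          have h3 : ε (k + 1) ≤ ε k := hε k.le_succ
          have h4 : (1 : ℝ) / (ε k / 2) ≤ 2 * (1 / ε (k + 1)) := by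
            rw [one_div_div, mul_one_div]
            gcongr
          have h6 := hε0 k
          calc 2 * η k * 5 ^ 2 ^ k * (1 / (ε k / 2)) ^ j
              ≤ 2 * η k * 25 ^ 2 ^ k * (2 * (1 / ε (k + 1))) ^ j := by
                gcongr
                norm_num
            _ = 2 ^ j * (2 * η k * 25 ^ 2 ^ k * (1 / ε (k + 1)) ^ j) := by
                rw [mul_pow]
                ring
            _ ≤ 2 ^ j * (L (j + 2) * ε (k + 1) ^ 2 * (1 / 2) ^ k) := by gcongr
            _ ≤ 2 ^ j * (L (j + 2) * ε (k + 1) ^ 2 * 1) := by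
                gcongr
                exact hhalf k
            _ = _ := by ring
        · have hx1 := hP x' hx' k t (ht.trans (by linarith [hε0 k]))
          have hx2 := hP x hx k t (by
            refine (abs_sub_le t x' x).trans ?_
            linarith)
          rw [Polynomial.eval_sub, ← sub_sub_sub_cancel_right _ _ (f t)]
          exact (norm_sub_le _ _).trans (by linarith)
      set A := (Polynomial.derivative^[j] (P x k)).eval (x : ℂ)
      set A' := (Polynomial.derivative^[j] (P x k)).eval (x' : ℂ)
      set A'' := (Polynomial.derivative^[j] (P x' k)).eval (x' : ℂ)
      set A1 := (Polynomial.derivative^[j + 1] (P x k)).eval (x : ℂ)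
      have hsplit : a j x' - a j x - (x' - x) • a (j + 1) x =
          (A' - A - A1 * (x' - x)) + (A'' - A') - (A'' - a j x') + (A - a j x) +
            (A1 - a (j + 1) x) * ((x' - x : ℝ) : ℂ) := by
        rw [Complex.real_smul]
        push_cast
        ring
      rw [hsplit, Real.norm_eq_abs, Real.norm_eq_abs, abs_pow, abs_abs, ← hd']
      have e6 : ‖(A1 - a (j + 1) x) * ((x' - x : ℝ) : ℂ)‖ ≤
          2 * ((j + 1).factorial * (L (j + 1 + 1) * ε (k + 1) ^ 1)) * d := by
        rw [norm_mul, Complex.norm_real, Real.norm_eq_abs, ← hd']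
        gcongr
      refine (norm_add_le_of_le (norm_add_le_of_le (norm_sub_le_of_le (norm_add_le_of_le e4 e5) e2)
        e1) e6).trans ?_
      have f1 : 0 ≤ 2 * ((j + 1).factorial * L (j + 2)) := by positivity
      have f2 : 0 ≤ 2 * (j.factorial * L (j + 2)) + 2 * (j.factorial * L (j + 2)) +
        j.factorial * (2 ^ j * L (j + 2)) := by positivity
      have g1 := mul_le_mul_of_nonneg_left hεsq f2
      have g2 := mul_le_mul_of_nonneg_left (mul_le_mul_of_nonneg_right hεd hd_nonneg) f1
      rw [hc]
      nlinarith [g1, g2]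
  · have := htail x hx 0 0 j
    simpa [hP0] using this

theorem contDiffOn_of_hasDerivAt_succ {U : Set ℝ} (hU : IsOpen U) {a : ℕ → ℝ → ℂ}
    (ha : ∀ j, ∀ x ∈ U, HasDerivAt (a j) (a (j + 1) x) x) : ContDiffOn ℝ (⊤ : ℕ∞) (a 0) U := by
  rw [contDiffOn_infty]
  suffices h : ∀ n j : ℕ, ContDiffOn ℝ n (a j) U from fun n => h n 0
  intro n
  induction n with
  | zero =>
    intro j
    exact contDiffOn_zero.mpr fun x hx => (ha j x hx).continuousAt.continuousWithinAt
  | succ n ih =>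
    intro j
    push_cast
    rw [contDiffOn_succ_iff_deriv_of_isOpen hU]
    exact ⟨fun x hx => (ha j x hx).differentiableAt.differentiableWithinAt, by simp,
      (ih (j + 1)).congr fun x hx => (ha j x hx).deriv⟩

theorem eqOn_iteratedDerivWithin_of_hasDerivAt_succ {U : Set ℝ} (hU : IsOpen U) {a : ℕ → ℝ → ℂ}
    (ha : ∀ j, ∀ x ∈ U, HasDerivAt (a j) (a (j + 1) x) x) (j : ℕ) :
    Set.EqOn (iteratedDerivWithin j (a 0) U) (a j) U := by
  induction j with
  | zero => intro x _; simp
  | succ j ih =>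
    intro x hx
    rw [iteratedDerivWithin_succ, derivWithin_congr ih (ih hx)]
    exact (ha j x hx).hasDerivWithinAt.derivWithin (hU.uniqueDiffOn x hx)

/-- Joris's theorem for Denjoy–Carleman classes: if `M` is a weight sequence with
moderate growth, `gcd p q = 1`, and `f^p`, `f^q` are smooth of class `C_M` on an open
set `Ω ⊆ ℝ`, then so is `f`. -/
theorem joris_denjoy_carleman
    (M : ℕ → ℝ) (hM : IsWeightSeq M) (hMG : ModerateGrowth M)
    (Ω : Set ℝ) (hΩ : IsOpen Ω) (f : ℝ → ℂ)
    (p q : ℕ) (hp : p ≠ 0) (hq : q ≠ 0) (hpq : Nat.gcd p q = 1)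
    (hfp : IsCMOn M (fun x => f x ^ p) Ω)
    (hfq : IsCMOn M (fun x => f x ^ q) Ω) :
    IsCMOn M f Ω := by
  obtain ⟨A, hA, hMA⟩ := hMG
  have key : ∀ X ⊆ Ω, IsCompact X → ∃ U : Set ℝ, IsOpen U ∧ X ⊆ U ∧ U ⊆ Ω ∧
      ContDiffOn ℝ (⊤ : ℕ∞) f U ∧ ∃ σ > 0, ∃ C ≥ 0, ∀ j : ℕ, ∀ x ∈ U,
        ‖iteratedDerivWithin j f U x‖ ≤ C * σ ^ j * (j.factorial : ℝ) * M j := by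
    intro X hXΩ hX
    obtain ⟨E, hE, hE1, hEA⟩ : ∃ E : ℝ, 0 < E ∧ E ≤ 1 ∧ E * 25 * A ^ 2 ≤ 1 / 2 := by
      refine ⟨1 / (50 * A ^ 2 + 1), by positivity, ?_, ?_⟩
      · rw [div_le_one (by positivity)]
        nlinarith [sq_nonneg A]
      · rw [div_mul_eq_mul_div, div_mul_eq_mul_div, div_le_div_iff₀ (by positivity) two_pos]
        nlinarith [sq_nonneg A]
    obtain ⟨U, hU, hXU, hUΩ, B, hB, C, hC, happ⟩ :=
      exists_local_polynomial_approx hM hΩ hp hq hpq hfp hfq hX hXΩ hE hE1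
    have hpoly : ∀ (x : ℝ) (k : ℕ), ∃ P : Polynomial ℂ, (k = 0 → P = 0) ∧ (x ∈ U →
        P.natDegree ≤ 2 ^ k ∧ ∀ y : ℝ, |y - x| ≤ 1 / (B * (M (2 ^ k + 1) / M (2 ^ k))) →
          ‖P.eval (y : ℂ) - f y‖ ≤ C / E * E ^ 2 ^ k) := by
      intro x k
      by_cases hx : x ∈ U
      · obtain ⟨P, hPd, hP⟩ := happ (2 ^ k) (by positivity) x hx
        rcases eq_or_ne k 0 with rfl | hk
        · refine ⟨0, fun _ => rfl, fun _ => ⟨by simp, fun y hy => ?_⟩⟩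
          rw [pow_zero, pow_one, div_mul_cancel₀ _ hE.ne', Polynomial.eval_zero, zero_sub, norm_neg]
          exact (hP y hy).1
        · refine ⟨P, fun h => absurd h hk, fun _ => ⟨hPd, fun y hy => (hP y hy).2.trans ?_⟩⟩
          gcongr
          exact le_div_self hC hE hE1
      · exact ⟨0, fun _ => rfl, fun h => absurd h hx⟩
    choose P hP0 hP using hpoly
    have hν0 : ∀ n, 0 < M (n + 1) / M n := fun n => zero_lt_one.trans_le (hM.one_le_ratio n)
    have hpow : StrictMono fun k : ℕ => 2 ^ k := pow_right_strictMono₀ one_lt_two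
    obtain ⟨a, ha0, ha, hab⟩ := exists_derivatives_of_polynomial_approx hU
      (f := f) (P := P) (ε := fun k => 1 / (B * (M (2 ^ k + 1) / M (2 ^ k))))
      (η := fun k => C / E * E ^ 2 ^ k) (L := fun j => 2 * (C / E) * ((A * B) ^ j * M j))
      (fun k => by have := hν0 (2 ^ k); positivity)
      (fun k l hkl => by
        have := hν0 (2 ^ k)
        exact one_div_le_one_div_of_le (by positivity)
          (mul_le_mul_of_nonneg_left (hM.monotone_ratio (hpow.monotone hkl)) hB.le))
      (by
        simp only [one_div]
        exact ((hM.tendsto_ratio.comp hpow.tendsto_atTop).const_mul_atTop hB).inv_tendsto_atTop)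
      (fun k => by positivity)
      (fun k l hkl => mul_le_mul_of_nonneg_left
        (pow_le_pow_of_le_one hE.le hE1 (hpow.monotone hkl)) (by positivity))
      (fun j k => by
        have h1 := hM.ratio_pow_mul_le j (2 ^ (k + 1))
        have h2 := hMA (2 ^ (k + 1)) j
        have hMpos := hM.1 (2 ^ (k + 1))
        have hMj := hM.1 j
        have h3 : (M (2 ^ (k + 1) + 1) / M (2 ^ (k + 1))) ^ j ≤
            (A ^ 2) ^ 2 ^ k * A ^ j * M j := by
          refine le_of_mul_le_mul_right ((h1.trans h2).trans (le_of_eq ?_)) hMpos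
          rw [pow_add, pow_succ 2, mul_comm (2 ^ k) 2, pow_mul]
          ring
        have h4 : ((1 : ℝ) / 2) ^ 2 ^ k ≤ (1 / 2) ^ k :=
          pow_le_pow_of_le_one (by norm_num) (by norm_num) Nat.lt_two_pow_self.le
        rw [one_div_one_div, mul_pow B]
        calc 2 * (C / E * E ^ 2 ^ k) * 25 ^ 2 ^ k *
              (B ^ j * (M (2 ^ (k + 1) + 1) / M (2 ^ (k + 1))) ^ j)
            ≤ 2 * (C / E * E ^ 2 ^ k) * 25 ^ 2 ^ k * (B ^ j * ((A ^ 2) ^ 2 ^ k * A ^ j * M j)) := by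
              gcongr
          _ = 2 * (C / E) * ((A * B) ^ j * M j) * (E * 25 * A ^ 2) ^ 2 ^ k := by
              rw [mul_pow _ (A ^ 2), mul_pow E, mul_pow A B]
              ring
          _ ≤ 2 * (C / E) * ((A * B) ^ j * M j) * (1 / 2) ^ 2 ^ k := by gcongr
          _ ≤ 2 * (C / E) * ((A * B) ^ j * M j) * (1 / 2) ^ k := by gcongr)
      (fun x => hP0 x 0 rfl) (fun x hx k => (hP x k hx).1) (fun x hx k => (hP x k hx).2)
    have hfa : Set.EqOn f (a 0) U := fun x hx => (ha0 x hx).symm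
    refine ⟨U, hU, hXU, hUΩ, (contDiffOn_of_hasDerivAt_succ hU ha).congr hfa, A * B, by positivity,
      4 * (C / E), by positivity, fun j x hx => ?_⟩
    rw [iteratedDerivWithin_congr hfa hx, eqOn_iteratedDerivWithin_of_hasDerivAt_succ hU ha j hx]
    exact (hab j x hx).trans (le_of_eq (by ring))
  constructor
  · intro x hx
    obtain ⟨U, hU, hxU, hUΩ, hfU, -⟩ := key {x} (by simpa using hx) isCompact_singleton
    have hxU' : x ∈ U := hxU rfl
    exact (hfU.contDiffAt (hU.mem_nhds hxU')).contDiffWithinAt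
  · intro X hXΩ hX
    obtain ⟨U, hU, hXU, hUΩ, -, σ, hσ, C, hC, hb⟩ := key X hXΩ hX
    refine ⟨σ, hσ, C, hC, fun j x hx => ?_⟩
    rw [iteratedDerivWithin_of_isOpen hΩ (hXΩ hx), ← iteratedDerivWithin_of_isOpen hU (hXU hx)]
    exact hb j x (hXU hx)
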